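/- arXiv:1006.3014 — 3 statements merged into one kernel-verified Lean document; each statement's English description precedes it below -/
import Mathlib

section
/- Let H be a Hopf algebra over a field k, and let A and B be two H-Galois objects (both left H-Galois or both right H-Galois). Then every H-colinear algebra morphism f : A → B is an isomorphism. Consequently the category of left (resp. right) H-Galois objects, with H-colinear algebra maps as morphisms, is a groupoid. -/
open TensorProduct

universe u

namespace HopfGalois

variable (k : Type u) [CommRing k]

section Coactions

variable (H : Type u) [Ring H] [Bialgebra k H]
variable {V : Type u} [AddCommGroup V] [Module k V]

/-- `ρ : V → V ⊗ H` is a (coassociative, counital) right `H`-coaction. -/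
structure IsRightCoaction (ρ : V →ₗ[k] V ⊗[k] H) : Prop where
  coassoc : (TensorProduct.assoc k V H H).toLinearMap ∘ₗ ρ.rTensor H ∘ₗ ρ
      = (Coalgebra.comul (R := k) (A := H)).lTensor V ∘ₗ ρ
  counit : (TensorProduct.rid k V).toLinearMap ∘ₗ
      (Coalgebra.counit (R := k) (A := H)).lTensor V ∘ₗ ρ = LinearMap.id

/-- `lam : V → H ⊗ V` is a (coassociative, counital) left `H`-coaction. -/
structure IsLeftCoaction (lam : V →ₗ[k] H ⊗[k] V) : Prop where
  coassoc : lam.lTensor H ∘ₗ lam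
      = (TensorProduct.assoc k H H V).toLinearMap ∘ₗ
          (Coalgebra.comul (R := k) (A := H)).rTensor V ∘ₗ lam
  counit : (TensorProduct.lid k V).toLinearMap ∘ₗ
      (Coalgebra.counit (R := k) (A := H)).rTensor V ∘ₗ lam = LinearMap.id

end Coactions

section ComoduleAlgebras

variable (H : Type u) [Ring H] [Bialgebra k H]
variable (A : Type u) [Ring A] [Algebra k A]

/-- `α : A → H ⊗ A` makes the `k`-algebra `A` a left `H`-comodule algebra. -/
structure IsLeftComoduleAlgebra (α : A →ₗ[k] H ⊗[k] A) : Prop where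
  coaction : IsLeftCoaction k H α
  map_one : α 1 = 1
  map_mul : ∀ a b : A, α (a * b) = α a * α b

/-- `β : A → A ⊗ H` makes the `k`-algebra `A` a right `H`-comodule algebra. -/
structure IsRightComoduleAlgebra (β : A →ₗ[k] A ⊗[k] H) : Prop where
  coaction : IsRightCoaction k H β
  map_one : β 1 = 1
  map_mul : ∀ a b : A, β (a * b) = β a * β b

/-- The canonical (Galois) map `A ⊗ A → H ⊗ A`, `a ⊗ b ↦ a₍₋₁₎ ⊗ a₍₀₎b`,
associated to a left coaction `α`. -/
noncomputable def leftCanonicalMap (α : A →ₗ[k] H ⊗[k] A) :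
    A ⊗[k] A →ₗ[k] H ⊗[k] A :=
  (LinearMap.mul' k A).lTensor H ∘ₗ (TensorProduct.assoc k H A A).toLinearMap ∘ₗ α.rTensor A

/-- The canonical (Galois) map `A ⊗ A → A ⊗ H`, `a ⊗ b ↦ ab₍₀₎ ⊗ b₍₁₎`,
associated to a right coaction `β`. -/
noncomputable def rightCanonicalMap (β : A →ₗ[k] A ⊗[k] H) :
    A ⊗[k] A →ₗ[k] A ⊗[k] H :=
  (LinearMap.mul' k A).rTensor H ∘ₗ (TensorProduct.assoc k A A H).symm.toLinearMap ∘ₗ β.lTensor A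

/-- A left `H`-Galois object structure: a nonzero left `H`-comodule algebra whose
canonical map is bijective. -/
structure IsLeftGaloisObject (α : A →ₗ[k] H ⊗[k] A) : Prop where
  comodAlg : IsLeftComoduleAlgebra k H A α
  nontrivial : Nontrivial A
  bijective : Function.Bijective (leftCanonicalMap k H A α)

/-- A right `H`-Galois object structure. -/
structure IsRightGaloisObject (β : A →ₗ[k] A ⊗[k] H) : Prop where
  comodAlg : IsRightComoduleAlgebra k H A β
  nontrivial : Nontrivial A
  bijective : Function.Bijective (rightCanonicalMap k H A β)

end ComoduleAlgebras

section Colinear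

variable {k} (H : Type u) [Ring H] [Bialgebra k H]
variable {A B : Type u} [AddCommGroup A] [Module k A] [AddCommGroup B] [Module k B]

/-- A linear map between left `H`-comodules is `H`-colinear. -/
def IsLeftColinear (α : A →ₗ[k] H ⊗[k] A) (α' : B →ₗ[k] H ⊗[k] B) (f : A →ₗ[k] B) : Prop :=
  α' ∘ₗ f = f.lTensor H ∘ₗ α

/-- A linear map between right `H`-comodules is `H`-colinear. -/
def IsRightColinear (β : A →ₗ[k] A ⊗[k] H) (β' : B →ₗ[k] B ⊗[k] H) (f : A →ₗ[k] B) : Prop :=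
  β' ∘ₗ f = f.rTensor H ∘ₗ β

end Colinear

section Cotensor

variable {k}
variable (C : Type u) [AddCommGroup C] [Module k C]
variable {V W : Type u} [AddCommGroup V] [Module k V] [AddCommGroup W] [Module k W]

/-- The cotensor product `V □_C W` of a right `C`-comodule and a left `C`-comodule,
as a submodule of `V ⊗ W`: the kernel of `ρ ⊗ 1 - 1 ⊗ lam`. -/
noncomputable def cotensor (ρ : V →ₗ[k] V ⊗[k] C) (lam : W →ₗ[k] C ⊗[k] W) :
    Submodule k (V ⊗[k] W) :=
  LinearMap.ker (ρ.rTensor W -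
    (TensorProduct.assoc k V C W).symm.toLinearMap ∘ₗ lam.lTensor V)

end Cotensor

end HopfGalois

open HopfGalois

namespace HopfGalois

section BaseExtension

variable {k : Type u} [CommRing k]

/-- The `B`-linear map `B ⊗ X → B ⊗ Y`, `b ⊗ x ↦ b • t x`, extending a `k`-linear map
`t : X → B ⊗ Y`, where `B` is a possibly noncommutative `k`-algebra. -/
noncomputable def extendLeft {B X Y : Type u} [Ring B] [Algebra k B]
    [AddCommGroup X] [Module k X] [AddCommGroup Y] [Module k Y] (t : X →ₗ[k] B ⊗[k] Y) :
    B ⊗[k] X →ₗ[B] B ⊗[k] Y :=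
  TensorProduct.AlgebraTensorModule.lift (LinearMap.toSpanSingleton B (X →ₗ[k] B ⊗[k] Y) t)

@[simp]
lemma extendLeft_tmul {B X Y : Type u} [Ring B] [Algebra k B]
    [AddCommGroup X] [Module k X] [AddCommGroup Y] [Module k Y] (t : X →ₗ[k] B ⊗[k] Y)
    (b : B) (x : X) : extendLeft t (b ⊗ₜ x) = b • t x := by
  simp [extendLeft]

variable {A B X Y : Type u} [Ring A] [Algebra k A] [Ring B] [Algebra k B]
  [AddCommGroup X] [Module k X] [AddCommGroup Y] [Module k Y]

lemma rTensor_smul (f : A →ₐ[k] B) (a : A) (x : A ⊗[k] X) :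
    f.toLinearMap.rTensor X (a • x) = f a • f.toLinearMap.rTensor X x := by
  induction x with
  | zero => simp
  | tmul c y => simp [TensorProduct.smul_tmul']
  | add x y hx hy => rw [smul_add, map_add, map_add, smul_add, hx, hy]

lemma extendLeft_rTensor (f : A →ₐ[k] B) (g : A ⊗[k] X →ₗ[A] A ⊗[k] Y)
    (t : X →ₗ[k] B ⊗[k] Y)
    (ht : ∀ x, t x = f.toLinearMap.rTensor Y (g (1 ⊗ₜ x))) (z : A ⊗[k] X) :
    extendLeft t (f.toLinearMap.rTensor X z) = f.toLinearMap.rTensor Y (g z) := by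
  induction z with
  | zero => simp
  | tmul a x =>
    have h : a ⊗ₜ[k] x = a • ((1 : A) ⊗ₜ[k] x) := by simp [TensorProduct.smul_tmul']
    rw [LinearMap.rTensor_tmul, extendLeft_tmul, ht, h, map_smul, rTensor_smul]
    rfl
  | add x y hx hy => simp only [map_add, hx, hy]

/-- Extending the scalars of an isomorphism `A ⊗ X ≃ A ⊗ Y` along `f : A → B` gives a
bijection `B ⊗ X → B ⊗ Y`. -/
lemma extendLeft_bijective (f : A →ₐ[k] B) (e : (A ⊗[k] X) ≃ₗ[A] (A ⊗[k] Y))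
    (t : X →ₗ[k] B ⊗[k] Y)
    (ht : ∀ x, t x = f.toLinearMap.rTensor Y (e (1 ⊗ₜ x))) :
    Function.Bijective (extendLeft t) := by
  let s : Y →ₗ[k] B ⊗[k] X := f.toLinearMap.rTensor X ∘ₗ
    (e.symm.toLinearMap.restrictScalars k) ∘ₗ TensorProduct.mk k A Y 1
  have hs (y : Y) : s y = f.toLinearMap.rTensor X (e.symm (1 ⊗ₜ y)) := rfl
  refine Function.bijective_iff_has_inverse.mpr ⟨extendLeft s, fun z ↦ ?_, fun z ↦ ?_⟩
  · induction z with
    | zero => simp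
    | tmul b x =>
      rw [extendLeft_tmul, map_smul, ht, extendLeft_rTensor f e.symm.toLinearMap s hs]
      simp [TensorProduct.smul_tmul']
    | add x y hx hy => simp only [map_add, hx, hy]
  · induction z with
    | zero => simp
    | tmul b y =>
      rw [extendLeft_tmul, map_smul, hs, extendLeft_rTensor f e.toLinearMap t ht]
      simp [TensorProduct.smul_tmul']
    | add x y hx hy => simp only [map_add, hx, hy]

end BaseExtension

/-- A linear map intertwining an isomorphism `A ⊗ V ≃ A ⊗ Y` with an isomorphism
`B ⊗ W ≃ B ⊗ Y` along an algebra map `A → B` with `B ≠ 0` is bijective. -/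
lemma bijective_of_tensor_equiv {k A B V W Y : Type u} [Field k] [Ring A] [Algebra k A]
    [Ring B] [Algebra k B] [Nontrivial B] [AddCommGroup V] [Module k V]
    [AddCommGroup W] [Module k W] [AddCommGroup Y] [Module k Y]
    (f : A →ₐ[k] B) (e : (A ⊗[k] V) ≃ₗ[A] (A ⊗[k] Y)) (e' : (B ⊗[k] W) ≃ₗ[B] (B ⊗[k] Y))
    (g : V →ₗ[k] W)
    (h : ∀ v, e' (1 ⊗ₜ g v) = f.toLinearMap.rTensor Y (e (1 ⊗ₜ v))) :
    Function.Bijective g := by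
  let t : V →ₗ[k] B ⊗[k] Y :=
    (e'.toLinearMap.restrictScalars k) ∘ₗ TensorProduct.mk k B W 1 ∘ₗ g
  have key : ⇑(extendLeft t) = e' ∘ g.lTensor B := by
    funext z
    induction z with
    | zero => simp
    | tmul b v =>
      simp [t, ← map_smul, TensorProduct.smul_tmul']
    | add x y hx hy => simp only [map_add, hx, hy, Function.comp_apply]
  have hb := extendLeft_bijective f e t h
  rw [key, e'.bijective.of_comp_iff'] at hb
  exact (Module.FaithfullyFlat.lTensor_bijective_iff_bijective k B g).mp hb

section CanonicalMaps

variable {k : Type u} [CommRing k] {H : Type u} [Ring H] [Bialgebra k H]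
  {A : Type u} [Ring A] [Algebra k A]

lemma rightCanonicalMap_tmul (β : A →ₗ[k] A ⊗[k] H) (a b : A) :
    rightCanonicalMap k H A β (a ⊗ₜ b) = a • β b := by
  simp only [rightCanonicalMap, LinearMap.comp_apply, LinearMap.lTensor_tmul]
  induction β b with
  | zero => simp
  | tmul c h => simp [TensorProduct.smul_tmul']
  | add x y hx hy => simp only [TensorProduct.tmul_add, map_add, smul_add, hx, hy]

/-- The bijective canonical map of a right Galois object, as a left `A`-linear equivalence. -/
noncomputable def rightCanonicalEquiv (β : A →ₗ[k] A ⊗[k] H)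
    (hβ : Function.Bijective (rightCanonicalMap k H A β)) :
    (A ⊗[k] A) ≃ₗ[A] (A ⊗[k] H) :=
  LinearEquiv.ofBijective
    { rightCanonicalMap k H A β with
      map_smul' := fun c z ↦ by
        change rightCanonicalMap k H A β (c • z) = c • rightCanonicalMap k H A β z
        induction z with
        | zero => simp
        | tmul a b =>
          rw [TensorProduct.smul_tmul', rightCanonicalMap_tmul, rightCanonicalMap_tmul,
            smul_eq_mul, mul_smul]
        | add x y hx hy => rw [smul_add, map_add, map_add, smul_add, hx, hy] } hβ

lemma rightCanonicalEquiv_one_tmul (β : A →ₗ[k] A ⊗[k] H)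
    (hβ : Function.Bijective (rightCanonicalMap k H A β)) (a : A) :
    rightCanonicalEquiv β hβ (1 ⊗ₜ a) = β a :=
  (rightCanonicalMap_tmul β 1 a).trans (one_smul A _)

variable (k) in
/-- The flip `A ⊗ X ≃ X ⊗ A`, with the source viewed as a left module over `Aᵐᵒᵖ`. -/
noncomputable def opFlip (A X : Type u) [Ring A] [Algebra k A] [AddCommGroup X] [Module k X] :
    (Aᵐᵒᵖ ⊗[k] X) ≃ₗ[k] (X ⊗[k] A) :=
  (TensorProduct.comm k Aᵐᵒᵖ X).trans
    ((MulOpposite.opLinearEquiv k (M := A)).symm.lTensor X)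

@[simp]
lemma opFlip_tmul {X : Type u} [AddCommGroup X] [Module k X] (a : Aᵐᵒᵖ) (x : X) :
    opFlip k A X (a ⊗ₜ x) = x ⊗ₜ a.unop := by
  simp [opFlip]

@[simp]
lemma opFlip_symm_tmul {X : Type u} [AddCommGroup X] [Module k X] (a : A) (x : X) :
    (opFlip k A X).symm (x ⊗ₜ a) = MulOpposite.op a ⊗ₜ x := by
  rw [LinearEquiv.symm_apply_eq, opFlip_tmul, MulOpposite.unop_op]

lemma opFlip_symm_leftCanonicalMap_tmul (α : A →ₗ[k] H ⊗[k] A) (a b : A) :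
    (opFlip k A H).symm (leftCanonicalMap k H A α (a ⊗ₜ b)) =
      MulOpposite.op b • (opFlip k A H).symm (α a) := by
  simp only [leftCanonicalMap, LinearMap.comp_apply, LinearMap.rTensor_tmul]
  induction α a with
  | zero => simp
  | tmul h c => simp [TensorProduct.smul_tmul']
  | add x y hx hy => simp only [TensorProduct.add_tmul, map_add, smul_add, hx, hy]

/-- The bijective canonical map of a left Galois object, as an `Aᵐᵒᵖ`-linear equivalence. -/
noncomputable def leftCanonicalEquiv (α : A →ₗ[k] H ⊗[k] A)
    (hα : Function.Bijective (leftCanonicalMap k H A α)) :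
    (Aᵐᵒᵖ ⊗[k] A) ≃ₗ[Aᵐᵒᵖ] (Aᵐᵒᵖ ⊗[k] H) :=
  let e := (opFlip k A A).trans
    ((LinearEquiv.ofBijective _ hα).trans (opFlip k A H).symm)
  { e with
    map_smul' := fun c z ↦ by
      change e (c • z) = c • e z
      have he (b : Aᵐᵒᵖ) (a : A) : e (b ⊗ₜ a) = b • (opFlip k A H).symm (α a) := by
        simp [e, opFlip_symm_leftCanonicalMap_tmul]
      induction z with
      | zero => simp
      | tmul b a => rw [TensorProduct.smul_tmul', he, he, smul_eq_mul, mul_smul]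
      | add x y hx hy => rw [smul_add, map_add, map_add, smul_add, hx, hy] }

lemma leftCanonicalEquiv_one_tmul (α : A →ₗ[k] H ⊗[k] A)
    (hα : Function.Bijective (leftCanonicalMap k H A α)) (a : A) :
    leftCanonicalEquiv α hα (1 ⊗ₜ a) = (opFlip k A H).symm (α a) := by
  change (opFlip k A H).symm (leftCanonicalMap k H A α (opFlip k A A (1 ⊗ₜ a))) = _
  rw [opFlip_tmul, opFlip_symm_leftCanonicalMap_tmul, MulOpposite.unop_one,
    MulOpposite.op_one, one_smul]

lemma opFlip_symm_lTensor {B X : Type u} [Ring B] [Algebra k B] [AddCommGroup X] [Module k X]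
    (f : A →ₐ[k] B) (z : X ⊗[k] A) :
    (opFlip k B X).symm (f.toLinearMap.lTensor X z) =
      (AlgHom.op f).toLinearMap.rTensor X ((opFlip k A X).symm z) := by
  induction z with
  | zero => simp
  | tmul x a => simp
  | add x y hx hy => simp only [map_add, hx, hy]

end CanonicalMaps

end HopfGalois

/-- Any `H`-colinear algebra morphism between two left (resp. right)
`H`-Galois objects is an isomorphism (i.e. bijective); hence the categories of left and
right `H`-Galois objects are groupoids. -/
theorem galois_hom_bijective (k : Type u) [Field k] (H : Type u) [Ring H] [HopfAlgebra k H] :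
    (∀ (A B : Type u) [Ring A] [Algebra k A] [Ring B] [Algebra k B]
      (α : A →ₗ[k] H ⊗[k] A) (α' : B →ₗ[k] H ⊗[k] B),
      IsLeftGaloisObject k H A α → IsLeftGaloisObject k H B α' →
      ∀ f : A →ₐ[k] B, IsLeftColinear H α α' f.toLinearMap →
        Function.Bijective f) ∧
    (∀ (A B : Type u) [Ring A] [Algebra k A] [Ring B] [Algebra k B]
      (β : A →ₗ[k] A ⊗[k] H) (β' : B →ₗ[k] B ⊗[k] H),
      IsRightGaloisObject k H A β → IsRightGaloisObject k H B β' →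
      ∀ f : A →ₐ[k] B, IsRightColinear H β β' f.toLinearMap →
        Function.Bijective f) := by
  refine ⟨fun A B _ _ _ _ α α' hα hα' f hf ↦ ?_, fun A B _ _ _ _ β β' hβ hβ' f hf ↦ ?_⟩
  · have := hα'.nontrivial
    refine bijective_of_tensor_equiv (AlgHom.op f) (leftCanonicalEquiv α hα.bijective)
      (leftCanonicalEquiv α' hα'.bijective) f.toLinearMap fun a ↦ ?_
    rw [leftCanonicalEquiv_one_tmul, leftCanonicalEquiv_one_tmul, ← opFlip_symm_lTensor]
    exact congrArg _ (LinearMap.congr_fun hf a)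
  · have := hβ'.nontrivial
    refine bijective_of_tensor_equiv f (rightCanonicalEquiv β hβ.bijective)
      (rightCanonicalEquiv β' hβ'.bijective) f.toLinearMap fun a ↦ ?_
    rw [rightCanonicalEquiv_one_tmul, rightCanonicalEquiv_one_tmul]
    exact LinearMap.congr_fun hf a
end

section
/- Let H be a Hopf algebra over a field k and let A be a left H-Galois object. The following assertions are equivalent: (1) there exists a 2-cocycle σ ∈ Z²(H) such that A ≅ H_{σ^{-1}} as left H-comodule algebras; (2) A ≅ H as left H-comodules; (3) there exists a convolution invertible H-colinear linear map φ : H → A. (A left H-Galois object satisfying these conditions is called cleft.) -/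
open TensorProduct

universe u

namespace HopfGalois

variable (k : Type u) [CommRing k]

section Convolution

variable {C B : Type u} [AddCommGroup C] [Module k C] [Coalgebra k C] [Ring B] [Algebra k B]

/-- Convolution product of two linear maps from a coalgebra to an algebra. -/
noncomputable def conv (φ ψ : C →ₗ[k] B) : C →ₗ[k] B :=
  LinearMap.mul' k B ∘ₗ TensorProduct.map φ ψ ∘ₗ Coalgebra.comul (R := k)

/-- The unit of the convolution algebra `Hom(C, B)`. -/
noncomputable def convUnit : C →ₗ[k] B :=
  Algebra.linearMap k B ∘ₗ Coalgebra.counit (R := k)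

/-- A linear map `C → B` is convolution invertible. -/
noncomputable def IsConvInvertible (φ : C →ₗ[k] B) : Prop :=
  ∃ ψ : C →ₗ[k] B, conv k φ ψ = convUnit k ∧ conv k ψ φ = convUnit k

end Convolution

section Cocycle

variable (H : Type u) [Ring H] [Bialgebra k H]

/-- `x ⊗ y ⊗ z ↦ σ(x ⊗ y) ε(z)`. -/
noncomputable def cocycleL1 (σ : H ⊗[k] H →ₗ[k] k) : (H ⊗[k] H) ⊗[k] H →ₗ[k] k :=
  LinearMap.mul' k k ∘ₗ TensorProduct.map σ (Coalgebra.counit (R := k))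

/-- `x ⊗ y ⊗ z ↦ σ(xy ⊗ z)`. -/
noncomputable def cocycleL2 (σ : H ⊗[k] H →ₗ[k] k) : (H ⊗[k] H) ⊗[k] H →ₗ[k] k :=
  σ ∘ₗ (LinearMap.mul' k H).rTensor H

/-- `x ⊗ y ⊗ z ↦ ε(x) σ(y ⊗ z)`. -/
noncomputable def cocycleR1 (σ : H ⊗[k] H →ₗ[k] k) : (H ⊗[k] H) ⊗[k] H →ₗ[k] k :=
  (LinearMap.mul' k k ∘ₗ TensorProduct.map (Coalgebra.counit (R := k)) σ) ∘ₗ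
    (TensorProduct.assoc k H H H).toLinearMap

/-- `x ⊗ y ⊗ z ↦ σ(x ⊗ yz)`. -/
noncomputable def cocycleR2 (σ : H ⊗[k] H →ₗ[k] k) : (H ⊗[k] H) ⊗[k] H →ₗ[k] k :=
  (σ ∘ₗ (LinearMap.mul' k H).lTensor H) ∘ₗ (TensorProduct.assoc k H H H).toLinearMap

/-- A (left, normalized) 2-cocycle on the bialgebra `H`: a convolution invertible linear map
`σ : H ⊗ H → k` such that `σ(x₍₁₎, y₍₁₎) σ(x₍₂₎y₍₂₎, z) = σ(y₍₁₎, z₍₁₎) σ(x, y₍₂₎z₍₂₎)`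
(written as an equality of convolution products on the tensor product coalgebra
`(H ⊗ H) ⊗ H`) and `σ(x, 1) = ε(x) = σ(1, x)`. -/
noncomputable def IsTwoCocycle (σ : H ⊗[k] H →ₗ[k] k) : Prop :=
  IsConvInvertible k σ ∧
  conv k (cocycleL1 k H σ) (cocycleL2 k H σ) = conv k (cocycleR1 k H σ) (cocycleR2 k H σ) ∧
  (∀ x : H, σ (x ⊗ₜ[k] 1) = Coalgebra.counit (R := k) x) ∧
  (∀ x : H, σ (1 ⊗ₜ[k] x) = Coalgebra.counit (R := k) x)

/-- The product of the twisted algebra `H_{σ'}`: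
`x · y = σ'(x₍₂₎ ⊗ y₍₂₎) x₍₁₎ y₍₁₎`. -/
noncomputable def twistedMul (σ' : H ⊗[k] H →ₗ[k] k) : H ⊗[k] H →ₗ[k] H :=
  (TensorProduct.rid k H).toLinearMap ∘ₗ
    TensorProduct.map (LinearMap.mul' k H) σ' ∘ₗ
      (TensorProduct.tensorTensorTensorComm k H H H H).toLinearMap ∘ₗ
        TensorProduct.map (Coalgebra.comul (R := k)) (Coalgebra.comul (R := k))

end Cocycle

end HopfGalois

open HopfGalois

namespace HopfGalois

open Coalgebra

section ConvAction

variable {k : Type u} [CommRing k]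
variable {C B : Type u} [AddCommGroup C] [Module k C] [Ring B] [Algebra k B]

lemma lTensor_mul'_assoc_tmul (t : C ⊗[k] B) (b : B) :
    (LinearMap.mul' k B).lTensor C (TensorProduct.assoc k C B B (t ⊗ₜ[k] b)) =
      (LinearMap.mulRight k b).lTensor C t := by
  induction t with
  | zero => simp
  | tmul x y => simp
  | add x y hx hy => simp only [add_tmul, map_add, hx, hy]

variable [Coalgebra k C]

/-- The endomorphism `c ⊗ b ↦ c₍₁₎ ⊗ φ(c₍₂₎)b` of `C ⊗ B`. -/
noncomputable def convAction (φ : C →ₗ[k] B) : C ⊗[k] B →ₗ[k] C ⊗[k] B :=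
  (LinearMap.mul' k B).lTensor C ∘ₗ (TensorProduct.assoc k C B B).toLinearMap ∘ₗ
    (φ.lTensor C ∘ₗ comul).rTensor B

lemma convAction_tmul (φ : C →ₗ[k] B) (c : C) (b : B) :
    convAction φ (c ⊗ₜ[k] b) = (LinearMap.mulRight k b ∘ₗ φ).lTensor C (comul c) := by
  simp only [convAction, LinearMap.comp_apply, LinearMap.rTensor_tmul, LinearEquiv.coe_coe,
    lTensor_mul'_assoc_tmul, LinearMap.lTensor_comp]

lemma convAction_comp_lTensor_mulRight (φ : C →ₗ[k] B) (b : B) :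
    convAction φ ∘ₗ (LinearMap.mulRight k b).lTensor C =
      (LinearMap.mulRight k b).lTensor C ∘ₗ convAction φ := by
  ext c a
  simp only [TensorProduct.AlgebraTensorModule.curry_apply, LinearMap.restrictScalars_self,
    TensorProduct.curry_apply, LinearMap.comp_apply, LinearMap.lTensor_tmul, convAction_tmul]
  rw [← LinearMap.lTensor_comp_apply, LinearMap.mulRight_apply, LinearMap.mulRight_mul,
    LinearMap.comp_assoc]

lemma convAction_conv (φ ψ : C →ₗ[k] B) :
    convAction (conv k φ ψ) = convAction φ ∘ₗ convAction ψ := by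
  have key (b : B) : convAction φ ∘ₗ (LinearMap.mulRight k b ∘ₗ ψ).lTensor C =
      (LinearMap.mulRight k b ∘ₗ LinearMap.mul' k B ∘ₗ TensorProduct.map φ ψ).lTensor C ∘ₗ
        (TensorProduct.assoc k C C C).toLinearMap ∘ₗ (comul (R := k)).rTensor C := by
    ext x y
    simp only [TensorProduct.AlgebraTensorModule.curry_apply, LinearMap.restrictScalars_self,
      TensorProduct.curry_apply, LinearMap.comp_apply, LinearMap.lTensor_tmul, convAction_tmul,
      LinearMap.rTensor_tmul, LinearEquiv.coe_coe]
    induction comul (R := k) x with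
    | zero => simp
    | tmul u v => simp [mul_assoc]
    | add s t hs ht => simp only [map_add, add_tmul, hs, ht]
  ext c b
  have h := LinearMap.congr_fun (key b) (comul (R := k) c)
  simp only [LinearMap.comp_apply, LinearEquiv.coe_coe, coassoc_apply] at h
  simp only [TensorProduct.AlgebraTensorModule.curry_apply, LinearMap.restrictScalars_self,
    TensorProduct.curry_apply, LinearMap.comp_apply, convAction_tmul, h]
  rw [← LinearMap.lTensor_comp_apply]
  rfl

lemma convAction_convUnit : convAction (convUnit k : C →ₗ[k] B) = LinearMap.id := by
  ext c b
  simp only [TensorProduct.AlgebraTensorModule.curry_apply, LinearMap.restrictScalars_self,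
    TensorProduct.curry_apply, convAction_tmul, convUnit, ← LinearMap.comp_assoc]
  rw [LinearMap.lTensor_comp, LinearMap.comp_apply, lTensor_counit_comul]
  simp

/-- `convAction` recovers its symbol: apply `ε` to the first leg at `b = 1`. -/
lemma lid_rTensor_counit_convAction_tmul_one (φ : C →ₗ[k] B) (c : C) :
    TensorProduct.lid k B ((counit (R := k)).rTensor B (convAction φ (c ⊗ₜ[k] 1))) = φ c := by
  have h : LinearMap.mulRight k (1 : B) ∘ₗ φ = φ := by ext; simp
  rw [convAction_tmul, h, ← LinearMap.comp_apply, LinearMap.rTensor_comp_lTensor,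
    ← LinearMap.lTensor_comp_rTensor, LinearMap.comp_apply, rTensor_counit_comul]
  simp

lemma convAction_injective :
    Function.Injective (convAction : (C →ₗ[k] B) → C ⊗[k] B →ₗ[k] C ⊗[k] B) := fun φ ψ h ↦ by
  ext c
  rw [← lid_rTensor_counit_convAction_tmul_one φ, h, lid_rTensor_counit_convAction_tmul_one]

lemma comul_rTensor_comp_convAction (φ : C →ₗ[k] B) :
    (TensorProduct.assoc k C C B).toLinearMap ∘ₗ (comul (R := k)).rTensor B ∘ₗ convAction φ =
      (convAction φ).lTensor C ∘ₗ (TensorProduct.assoc k C C B).toLinearMap ∘ₗ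
        (comul (R := k)).rTensor B := by
  have hl (g : C →ₗ[k] B) : (TensorProduct.assoc k C C B).toLinearMap ∘ₗ
      (comul (R := k)).rTensor B ∘ₗ g.lTensor C =
        (g.lTensor C).lTensor C ∘ₗ (TensorProduct.assoc k C C C).toLinearMap ∘ₗ
          (comul (R := k)).rTensor C := by
    ext x y
    simp only [TensorProduct.AlgebraTensorModule.curry_apply, LinearMap.restrictScalars_self,
      TensorProduct.curry_apply, LinearMap.comp_apply, LinearMap.lTensor_tmul,
      LinearMap.rTensor_tmul, LinearEquiv.coe_coe]
    induction comul (R := k) x with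
    | zero => simp
    | tmul u v => simp
    | add s t hs ht => simp only [map_add, add_tmul, hs, ht]
  have hr (b : B) (t : C ⊗[k] C) :
      (convAction φ).lTensor C (TensorProduct.assoc k C C B (t ⊗ₜ[k] b)) =
        ((LinearMap.mulRight k b ∘ₗ φ).lTensor C).lTensor C ((comul (R := k)).lTensor C t) := by
    induction t with
    | zero => simp
    | tmul x y => simp [convAction_tmul]
    | add s t hs ht => simp only [map_add, add_tmul, hs, ht]
  ext c b
  have h := LinearMap.congr_fun (hl (LinearMap.mulRight k b ∘ₗ φ)) (comul (R := k) c)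
  simp only [LinearMap.comp_apply, LinearEquiv.coe_coe, coassoc_apply] at h
  simp only [TensorProduct.AlgebraTensorModule.curry_apply, LinearMap.restrictScalars_self,
    TensorProduct.curry_apply, LinearMap.comp_apply, convAction_tmul, LinearMap.rTensor_tmul,
    LinearEquiv.coe_coe, h, hr]

/-- A left `C`-colinear and right `B`-linear endomorphism of `C ⊗ B` comes from `Hom(C, B)`. -/
lemma exists_convAction_eq (T : C ⊗[k] B →ₗ[k] C ⊗[k] B)
    (hlin : ∀ b : B, T ∘ₗ (LinearMap.mulRight k b).lTensor C =
      (LinearMap.mulRight k b).lTensor C ∘ₗ T)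
    (hcolin : (TensorProduct.assoc k C C B).toLinearMap ∘ₗ (comul (R := k)).rTensor B ∘ₗ T =
      T.lTensor C ∘ₗ (TensorProduct.assoc k C C B).toLinearMap ∘ₗ (comul (R := k)).rTensor B) :
    ∃ ψ : C →ₗ[k] B, convAction ψ = T := by
  let e : C ⊗[k] B →ₗ[k] B := (TensorProduct.lid k B).toLinearMap ∘ₗ (counit (R := k)).rTensor B
  let i : C →ₗ[k] C ⊗[k] B := (TensorProduct.mk k C B).flip 1
  refine ⟨e ∘ₗ T ∘ₗ i, ?_⟩
  have h1 (c : C) : (e ∘ₗ T ∘ₗ i).lTensor C (comul (R := k) c) = T (c ⊗ₜ[k] 1) := by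
    have he : e.lTensor C ∘ₗ (TensorProduct.assoc k C C B).toLinearMap ∘ₗ
        (comul (R := k)).rTensor B = LinearMap.id := by
      have ha : e.lTensor C ∘ₗ (TensorProduct.assoc k C C B).toLinearMap =
          ((TensorProduct.rid k C).toLinearMap ∘ₗ (counit (R := k)).lTensor C).rTensor B := by
        ext x y b
        simp [e, smul_tmul]
      rw [← LinearMap.comp_assoc, ha, ← LinearMap.rTensor_comp]
      convert LinearMap.rTensor_id B C
      ext c
      simp
    have hi : i.lTensor C (comul (R := k) c) = TensorProduct.assoc k C C B
        ((comul (R := k)).rTensor B (c ⊗ₜ[k] 1)) := by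
      rw [LinearMap.rTensor_tmul]
      induction comul (R := k) c with
      | zero => simp
      | tmul u v => simp [i]
      | add s t hs ht => simp only [map_add, add_tmul, hs, ht]
    have h := congrArg (e.lTensor C) (LinearMap.congr_fun hcolin (c ⊗ₜ[k] 1))
    have h' := LinearMap.congr_fun he (T (c ⊗ₜ[k] 1))
    simp only [LinearMap.comp_apply, LinearEquiv.coe_coe, LinearMap.id_apply] at h h'
    rw [LinearMap.lTensor_comp_apply C (g := e), LinearMap.lTensor_comp_apply C (g := T), hi, ← h, h']
  ext c b
  have h := LinearMap.congr_fun (hlin b) (c ⊗ₜ[k] 1)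
  simp only [LinearMap.comp_apply, LinearMap.lTensor_tmul, LinearMap.mulRight_apply,
    one_mul] at h
  simp only [TensorProduct.AlgebraTensorModule.curry_apply, LinearMap.restrictScalars_self,
    TensorProduct.curry_apply, convAction_tmul, h, ← h1]
  rw [LinearMap.lTensor_comp, LinearMap.comp_apply]

theorem isConvInvertible_iff_bijective_convAction (φ : C →ₗ[k] B) :
    IsConvInvertible k φ ↔ Function.Bijective (convAction φ) := by
  constructor
  · rintro ⟨ψ, h, h'⟩
    refine Function.bijective_iff_has_inverse.2 ⟨convAction ψ, fun x ↦ ?_, fun x ↦ ?_⟩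
    · rw [← LinearMap.comp_apply, ← convAction_conv, h', convAction_convUnit, LinearMap.id_apply]
    · rw [← LinearMap.comp_apply, ← convAction_conv, h, convAction_convUnit, LinearMap.id_apply]
  · intro hφ
    let E := LinearEquiv.ofBijective (convAction φ) hφ
    have hl : E.symm.toLinearMap ∘ₗ convAction φ = LinearMap.id :=
      LinearMap.ext E.symm_apply_apply
    have hr : convAction φ ∘ₗ E.symm.toLinearMap = LinearMap.id :=
      LinearMap.ext E.apply_symm_apply
    obtain ⟨ψ, hψ⟩ := exists_convAction_eq E.symm.toLinearMap (fun b ↦ by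
      have h := congrArg (fun g ↦ E.symm.toLinearMap ∘ₗ g ∘ₗ E.symm.toLinearMap)
        (convAction_comp_lTensor_mulRight φ b)
      simp only [LinearMap.comp_assoc, hr, LinearMap.comp_id] at h
      rw [← LinearMap.comp_assoc _ (convAction φ), hl, LinearMap.id_comp] at h
      exact h.symm) (by
      have hl' : E.symm.toLinearMap.lTensor C ∘ₗ (convAction φ).lTensor C = LinearMap.id := by
        rw [← LinearMap.lTensor_comp, hl, LinearMap.lTensor_id]
      have h := congrArg (fun g ↦ E.symm.toLinearMap.lTensor C ∘ₗ g ∘ₗ E.symm.toLinearMap)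
        (comul_rTensor_comp_convAction φ)
      simp only [LinearMap.comp_assoc, hr, LinearMap.comp_id] at h
      rw [← LinearMap.comp_assoc _ ((convAction φ).lTensor C), hl', LinearMap.id_comp] at h
      exact h.symm)
    refine ⟨ψ, convAction_injective ?_, convAction_injective ?_⟩
    · rw [convAction_conv, hψ, hr, convAction_convUnit]
    · rw [convAction_conv, hψ, hl, convAction_convUnit]

end ConvAction

end HopfGalois

namespace HopfGalois

open Coalgebra WithConv

section CleftIff

variable {k : Type u} [Field k] {H : Type u} [Ring H] [Bialgebra k H]
variable {A : Type u} [Ring A] [Algebra k A] {α : A →ₗ[k] H ⊗[k] A}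

/-- For a Galois object, a colinear map `H → A` is bijective iff it is convolution invertible:
tensored with `A` and followed by the canonical map, it is the endomorphism `convAction φ`. -/
theorem IsLeftGaloisObject.bijective_iff_isConvInvertible (hA : IsLeftGaloisObject k H A α)
    {φ : H →ₗ[k] A} (hφ : IsLeftColinear H (comul (R := k)) α φ) :
    Function.Bijective φ ↔ IsConvInvertible k φ := by
  have := hA.nontrivial
  have h : leftCanonicalMap k H A α ∘ₗ φ.rTensor A = convAction φ := by
    rw [convAction, ← show α ∘ₗ φ = _ from hφ, LinearMap.rTensor_comp]
    rfl
  rw [isConvInvertible_iff_bijective_convAction, ← h, LinearMap.coe_comp,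
    Function.Bijective.of_comp_iff' hA.bijective]
  exact ((Module.FaithfullyFlat.lTensor_bijective_iff_bijective k A φ).symm).trans
    (and_congr (LinearMap.lTensor_inj_iff_rTensor_inj A φ)
      (LinearMap.lTensor_surj_iff_rTensor_surj A φ))

/-- The coinvariants of a Galois object are the scalars. -/
lemma IsLeftGaloisObject.exists_algebraMap_eq (hA : IsLeftGaloisObject k H A α) {a : A}
    (ha : α a = 1 ⊗ₜ[k] a) : ∃ c : k, algebraMap k A c = a := by
  have := hA.nontrivial
  have h1 : α 1 = (1 : H) ⊗ₜ[k] (1 : A) := hA.comodAlg.map_one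
  have h : a ⊗ₜ[k] (1 : A) = 1 ⊗ₜ[k] a := hA.bijective.1 (by simp [leftCanonicalMap, ha, h1])
  obtain ⟨l, hl⟩ := Module.Projective.exists_dual_ne_zero k (one_ne_zero (α := A))
  have h' := congrArg (TensorProduct.lid k A ∘ l.rTensor A) h
  simp only [Function.comp_apply, LinearMap.rTensor_tmul, TensorProduct.lid_tmul] at h'
  refine ⟨(l 1)⁻¹ * l a, ?_⟩
  rw [Algebra.algebraMap_eq_smul_one, mul_smul, h', smul_smul, inv_mul_cancel₀ hl, one_smul]

/-- A colinear isomorphism `H ≃ A` can be rescaled so as to preserve the units. -/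
lemma IsLeftGaloisObject.exists_colinear_map_one (hA : IsLeftGaloisObject k H A α)
    (f : H ≃ₗ[k] A) (hf : IsLeftColinear H (comul (R := k)) α (f : H →ₗ[k] A)) :
    ∃ g : H ≃ₗ[k] A, g 1 = 1 ∧ IsLeftColinear H (comul (R := k)) α (g : H →ₗ[k] A) := by
  have := hA.nontrivial
  have : Nontrivial H := f.toEquiv.nontrivial
  obtain ⟨c, hc⟩ := hA.exists_algebraMap_eq (a := f 1) <| by
    simpa [Algebra.TensorProduct.one_def] using LinearMap.congr_fun hf 1
  have hc0 : c ≠ 0 := fun h ↦ one_ne_zero (α := H) <| f.injective <| by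
    rw [← hc, h, map_zero, map_zero]
  refine ⟨f.trans (LinearEquiv.smulOfNeZero k A c⁻¹ (inv_ne_zero hc0)), ?_, ?_⟩
  · simp [← hc, Algebra.algebraMap_eq_smul_one, smul_smul, mul_inv_cancel₀ hc0]
  · have h : ((f.trans (LinearEquiv.smulOfNeZero k A c⁻¹ (inv_ne_zero hc0))) : H →ₗ[k] A) =
        c⁻¹ • (f : H →ₗ[k] A) := rfl
    rw [h, IsLeftColinear, LinearMap.comp_smul, LinearMap.lTensor_smul, LinearMap.smul_comp]
    exact congrArg _ hf

end CleftIff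

section Convolution

variable {k : Type u} [CommRing k]
variable {C D B : Type u} [AddCommGroup C] [Module k C] [Coalgebra k C] [AddCommGroup D]
  [Module k D] [Coalgebra k D] [Ring B] [Algebra k B]

lemma conv_assoc (φ ψ χ : C →ₗ[k] B) :
    conv k (conv k φ ψ) χ = conv k φ (conv k ψ χ) :=
  congrArg ofConv (mul_assoc (toConv φ) (toConv ψ) (toConv χ))

lemma convUnit_conv (φ : C →ₗ[k] B) : conv k (convUnit k) φ = φ :=
  congrArg ofConv (one_mul (toConv φ))

lemma conv_convUnit (φ : C →ₗ[k] B) : conv k φ (convUnit k) = φ :=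
  congrArg ofConv (mul_one (toConv φ))

lemma conv_comp_coalgHom (φ ψ : C →ₗ[k] B) (h : D →ₗc[k] C) :
    conv k φ ψ ∘ₗ h.toLinearMap = conv k (φ ∘ₗ h.toLinearMap) (ψ ∘ₗ h.toLinearMap) :=
  LinearMap.convMul_comp_coalgHom_distrib (toConv φ) (toConv ψ) h

lemma convUnit_comp_coalgHom (h : D →ₗc[k] C) :
    (convUnit k : C →ₗ[k] B) ∘ₗ h.toLinearMap = convUnit k := by
  rw [convUnit, LinearMap.comp_assoc, h.counit_comp, convUnit]

lemma IsConvInvertible.comp_coalgHom {φ : C →ₗ[k] B} (hφ : IsConvInvertible k φ)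
    (h : D →ₗc[k] C) : IsConvInvertible k (φ ∘ₗ h.toLinearMap) := by
  obtain ⟨ψ, h₁, h₂⟩ := hφ
  refine ⟨ψ ∘ₗ h.toLinearMap, ?_, ?_⟩
  · rw [← conv_comp_coalgHom, h₁, convUnit_comp_coalgHom]
  · rw [← conv_comp_coalgHom, h₂, convUnit_comp_coalgHom]

lemma isConvInvertible_iff_isUnit (φ : C →ₗ[k] B) :
    IsConvInvertible k φ ↔ IsUnit (toConv φ) := by
  rw [isUnit_iff_exists]
  exact ⟨fun ⟨ψ, h₁, h₂⟩ ↦ ⟨toConv ψ, congrArg toConv h₁, congrArg toConv h₂⟩,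
    fun ⟨ψ, h₁, h₂⟩ ↦ ⟨ψ.ofConv, congrArg ofConv h₁, congrArg ofConv h₂⟩⟩

/-- If `a * b = c * d` for the convolution product, the inverses satisfy `b⁻¹ * a⁻¹ = d⁻¹ * c⁻¹`. -/
lemma conv_eq_conv_of_inverse {a b c d a' b' c' d' : C →ₗ[k] B} (h : conv k a b = conv k c d)
    (ha : conv k a' a = convUnit k) (hb : conv k b' b = convUnit k)
    (hc : conv k c c' = convUnit k) (hd : conv k d d' = convUnit k) :
    conv k b' a' = conv k d' c' := by
  have h₁ : conv k (conv k b' a') (conv k a b) = convUnit k := by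
    rw [conv_assoc, ← conv_assoc a', ha, convUnit_conv, hb]
  have h₂ : conv k (conv k c d) (conv k d' c') = convUnit k := by
    rw [conv_assoc, ← conv_assoc d, hd, convUnit_conv, hc]
  rw [← conv_convUnit (conv k b' a'), ← h₂, ← h, ← conv_assoc, h₁, convUnit_conv]

/-- The coalgebra map `C ⊗ D → C`, `c ⊗ d ↦ ε(d)c`. -/
noncomputable def fstCoalgHom (k C D : Type u) [CommRing k] [AddCommGroup C] [Module k C]
    [Coalgebra k C] [AddCommGroup D] [Module k D] [Coalgebra k D] : C ⊗[k] D →ₗc[k] C :=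
  (Coalgebra.TensorProduct.rid k k C).toCoalgHom.comp
    (Coalgebra.TensorProduct.map (CoalgHom.id k C) (counitCoalgHom k D))

/-- The coalgebra map `C ⊗ D → D`, `c ⊗ d ↦ ε(c)d`. -/
noncomputable def sndCoalgHom (k C D : Type u) [CommRing k] [AddCommGroup C] [Module k C]
    [Coalgebra k C] [AddCommGroup D] [Module k D] [Coalgebra k D] : C ⊗[k] D →ₗc[k] D :=
  (Coalgebra.TensorProduct.lid k D).toCoalgHom.comp
    (Coalgebra.TensorProduct.map (counitCoalgHom k C) (CoalgHom.id k D))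

@[simp] lemma fstCoalgHom_tmul (c : C) (d : D) :
    fstCoalgHom k C D (c ⊗ₜ[k] d) = counit (R := k) d • c := rfl

@[simp] lemma sndCoalgHom_tmul (c : C) (d : D) :
    sndCoalgHom k C D (c ⊗ₜ[k] d) = counit (R := k) c • d := rfl

/-- `c ⊗ d ↦ φ(c)ψ(d)` is the convolution product of `φ ⊗ ε` and `ε ⊗ ψ`. -/
lemma conv_comp_fstCoalgHom_comp_sndCoalgHom (φ : C →ₗ[k] B) (ψ : D →ₗ[k] B) :
    conv k (φ ∘ₗ (fstCoalgHom k C D).toLinearMap) (ψ ∘ₗ (sndCoalgHom k C D).toLinearMap) =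
      LinearMap.mul' k B ∘ₗ TensorProduct.map φ ψ := by
  have h : TensorProduct.map (φ ∘ₗ (fstCoalgHom k C D).toLinearMap)
      (ψ ∘ₗ (sndCoalgHom k C D).toLinearMap) ∘ₗ
        (TensorProduct.tensorTensorTensorComm k C C D D).toLinearMap =
      TensorProduct.map (φ ∘ₗ (TensorProduct.rid k C).toLinearMap ∘ₗ (counit (R := k)).lTensor C)
        (ψ ∘ₗ (TensorProduct.lid k D).toLinearMap ∘ₗ (counit (R := k)).rTensor D) := by
    ext c c' d d'
    simpa [smul_tmul] using
      smul_comm (counit (R := k) c') (counit (R := k) d) (φ c ⊗ₜ[k] ψ d')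
  ext c d
  have h' := LinearMap.congr_fun h (comul (R := k) c ⊗ₜ comul (R := k) d)
  simp only [LinearMap.comp_apply, LinearEquiv.coe_coe, TensorProduct.map_tmul,
    lTensor_counit_comul, rTensor_counit_comul, TensorProduct.lid_tmul, TensorProduct.rid_tmul,
    one_smul] at h'
  exact congrArg (LinearMap.mul' k B) h'

end Convolution

lemma isConvInvertible_of_algebraMap_comp {k : Type u} [Field k] {C B : Type u} [AddCommGroup C]
    [Module k C] [Coalgebra k C] [Ring B] [Nontrivial B] [Algebra k B] {σ : C →ₗ[k] k}
    (h : IsConvInvertible k (Algebra.linearMap k B ∘ₗ σ)) : IsConvInvertible k σ := by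
  obtain ⟨τ, h₁, h₂⟩ := h
  obtain ⟨l, hl⟩ : ∃ l : B →ₗ[k] k, l 1 = 1 := by
    obtain ⟨l, hl⟩ := Module.Projective.exists_dual_ne_zero k (one_ne_zero (α := B))
    exact ⟨(l 1)⁻¹ • l, by simp [hl]⟩
  have hu : l ∘ₗ (convUnit k : C →ₗ[k] B) = convUnit k := by
    ext c
    simp [convUnit, Algebra.algebraMap_eq_smul_one, hl]
  refine ⟨l ∘ₗ τ, ?_, ?_⟩
  · rw [← hu, ← h₁]
    ext c
    simp only [conv, LinearMap.comp_apply]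
    induction comul (R := k) c with
    | zero => simp
    | tmul u v => simp [← Algebra.smul_def]
    | add s t hs ht => simp only [map_add, hs, ht]
  · rw [← hu, ← h₂]
    ext c
    simp only [conv, LinearMap.comp_apply]
    induction comul (R := k) c with
    | zero => simp
    | tmul u v => simp [← Algebra.commutes, ← Algebra.smul_def, mul_comm]
    | add s t hs ht => simp only [map_add, hs, ht]

section Twist

variable {k : Type u} [CommRing k] {H : Type u} [Ring H] [Bialgebra k H]

lemma twistedMul_eq_comp_comul (σ : H ⊗[k] H →ₗ[k] k) :
    twistedMul k H σ = (TensorProduct.rid k H).toLinearMap ∘ₗ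
      TensorProduct.map (LinearMap.mul' k H) σ ∘ₗ comul (R := k) := rfl

lemma twistedMul_counit_comp {M : H ⊗[k] H →ₗ[k] H}
    (hM : comul (R := k) ∘ₗ M = TensorProduct.map (LinearMap.mul' k H) M ∘ₗ comul (R := k)) :
    twistedMul k H (counit (R := k) ∘ₗ M) = M := by
  have h : TensorProduct.map (LinearMap.mul' k H) (counit (R := k) ∘ₗ M) =
      (counit (R := k)).lTensor H ∘ₗ TensorProduct.map (LinearMap.mul' k H) M := by
    rw [LinearMap.lTensor_comp_map]
  rw [twistedMul_eq_comp_comul, h, LinearMap.comp_assoc, ← hM]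
  ext x y
  simp

lemma counit_comp_twistedMul (σ : H ⊗[k] H →ₗ[k] k) :
    counit (R := k) ∘ₗ twistedMul k H σ = σ := by
  have h : counit (R := k) ∘ₗ (TensorProduct.rid k H).toLinearMap ∘ₗ
      TensorProduct.map (LinearMap.mul' k H) σ =
        σ ∘ₗ (TensorProduct.lid k (H ⊗[k] H)).toLinearMap ∘ₗ
          (counit (R := k)).rTensor (H ⊗[k] H) := by
    ext x y z w
    simp [mul_comm]
  refine LinearMap.ext fun x ↦ (LinearMap.congr_fun h (comul (R := k) x)).trans ?_
  rw [LinearMap.comp_apply, LinearMap.comp_apply, rTensor_counit_comul]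
  simp

lemma comp_twistedMul {B : Type u} [Ring B] [Algebra k B] (f : H →ₗ[k] B)
    (σ : H ⊗[k] H →ₗ[k] k) :
    f ∘ₗ twistedMul k H σ = conv k (f ∘ₗ LinearMap.mul' k H) (Algebra.linearMap k B ∘ₗ σ) := by
  have h : f ∘ₗ (TensorProduct.rid k H).toLinearMap ∘ₗ TensorProduct.map (LinearMap.mul' k H) σ =
      LinearMap.mul' k B ∘ₗ
        TensorProduct.map (f ∘ₗ LinearMap.mul' k H) (Algebra.linearMap k B ∘ₗ σ) := by
    ext x y z w
    simp [← Algebra.commutes, ← Algebra.smul_def]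
  exact LinearMap.ext fun x ↦ LinearMap.congr_fun h (comul (R := k) x)

lemma cocycleL1_eq (σ : H ⊗[k] H →ₗ[k] k) :
    cocycleL1 k H σ = σ ∘ₗ (fstCoalgHom k (H ⊗[k] H) H).toLinearMap := by
  ext x y z
  simp [cocycleL1, mul_comm]

lemma cocycleL2_eq (σ : H ⊗[k] H →ₗ[k] k) :
    cocycleL2 k H σ = σ ∘ₗ (Coalgebra.TensorProduct.map (Bialgebra.mulCoalgHom k H)
      (CoalgHom.id k H)).toLinearMap := rfl

lemma cocycleR1_eq (σ : H ⊗[k] H →ₗ[k] k) :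
    cocycleR1 k H σ = σ ∘ₗ ((sndCoalgHom k H (H ⊗[k] H)).comp
      (Coalgebra.TensorProduct.assoc k k H H H).toCoalgHom).toLinearMap := by
  ext x y z
  simp [cocycleR1]

lemma cocycleR2_eq (σ : H ⊗[k] H →ₗ[k] k) :
    cocycleR2 k H σ = σ ∘ₗ ((Coalgebra.TensorProduct.map (CoalgHom.id k H)
      (Bialgebra.mulCoalgHom k H)).comp
        (Coalgebra.TensorProduct.assoc k k H H H).toCoalgHom).toLinearMap := rfl

lemma conv_cocycleL2_cocycleL1 (σ : H ⊗[k] H →ₗ[k] k) :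
    conv k (cocycleL2 k H σ) (cocycleL1 k H σ) = σ ∘ₗ (twistedMul k H σ).rTensor H := by
  have h : LinearMap.mul' k k ∘ₗ TensorProduct.map (cocycleL2 k H σ) (cocycleL1 k H σ) ∘ₗ
      (TensorProduct.tensorTensorTensorComm k (H ⊗[k] H) (H ⊗[k] H) H H).toLinearMap =
      σ ∘ₗ TensorProduct.map
        ((TensorProduct.rid k H).toLinearMap ∘ₗ TensorProduct.map (LinearMap.mul' k H) σ)
        ((TensorProduct.rid k H).toLinearMap ∘ₗ (counit (R := k)).lTensor H) := by
    ext x y z w u v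
    simp [cocycleL1, cocycleL2, smul_tmul, mul_comm, mul_left_comm]
  ext x y z
  have h' := LinearMap.congr_fun h (comul (R := k) (x ⊗ₜ[k] y) ⊗ₜ comul (R := k) z)
  simp only [LinearMap.comp_apply, LinearEquiv.coe_coe, TensorProduct.map_tmul,
    lTensor_counit_comul, TensorProduct.rid_tmul, one_smul] at h'
  exact h'

lemma conv_cocycleR2_cocycleR1 (σ : H ⊗[k] H →ₗ[k] k) :
    conv k (cocycleR2 k H σ) (cocycleR1 k H σ) =
      σ ∘ₗ (twistedMul k H σ).lTensor H ∘ₗ (TensorProduct.assoc k H H H).toLinearMap := by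
  have h : LinearMap.mul' k k ∘ₗ TensorProduct.map (σ ∘ₗ (LinearMap.mul' k H).lTensor H)
      (σ ∘ₗ (sndCoalgHom k H (H ⊗[k] H)).toLinearMap) ∘ₗ
      (TensorProduct.tensorTensorTensorComm k H H (H ⊗[k] H) (H ⊗[k] H)).toLinearMap =
      σ ∘ₗ TensorProduct.map
        ((TensorProduct.rid k H).toLinearMap ∘ₗ (counit (R := k)).lTensor H)
        ((TensorProduct.rid k H).toLinearMap ∘ₗ TensorProduct.map (LinearMap.mul' k H) σ) := by
    ext x y z w u v
    simp [smul_tmul, mul_comm, mul_left_comm]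
  have h' : conv k (σ ∘ₗ (LinearMap.mul' k H).lTensor H)
      (σ ∘ₗ (sndCoalgHom k H (H ⊗[k] H)).toLinearMap) = σ ∘ₗ (twistedMul k H σ).lTensor H := by
    ext x y z
    have h' := LinearMap.congr_fun h (comul (R := k) x ⊗ₜ comul (R := k) (y ⊗ₜ[k] z))
    simp only [LinearMap.comp_apply, LinearEquiv.coe_coe, TensorProduct.map_tmul,
      lTensor_counit_comul, TensorProduct.rid_tmul, one_smul] at h'
    exact h'
  let e := (Coalgebra.TensorProduct.assoc k k H H H).toCoalgHom
  have he := conv_comp_coalgHom (σ ∘ₗ (LinearMap.mul' k H).lTensor H)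
    (σ ∘ₗ (sndCoalgHom k H (H ⊗[k] H)).toLinearMap) e
  rw [h'] at he
  have h2 : cocycleR2 k H σ = (σ ∘ₗ (LinearMap.mul' k H).lTensor H) ∘ₗ e.toLinearMap := rfl
  have h1 : cocycleR1 k H σ =
      (σ ∘ₗ (sndCoalgHom k H (H ⊗[k] H)).toLinearMap) ∘ₗ e.toLinearMap := cocycleR1_eq σ
  rw [h1, h2]
  exact he.symm

/-- The coalgebra map `x ↦ x ⊗ 1`. -/
noncomputable def tmulOneCoalgHom (k H : Type u) [CommRing k] [Ring H] [Bialgebra k H] :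
    H →ₗc[k] H ⊗[k] H :=
  (Coalgebra.TensorProduct.map (CoalgHom.id k H) (Bialgebra.unitBialgHom k H).toCoalgHom).comp
    (Coalgebra.TensorProduct.rid k k H).symm.toCoalgHom

/-- The coalgebra map `x ↦ 1 ⊗ x`. -/
noncomputable def oneTmulCoalgHom (k H : Type u) [CommRing k] [Ring H] [Bialgebra k H] :
    H →ₗc[k] H ⊗[k] H :=
  (Coalgebra.TensorProduct.map (Bialgebra.unitBialgHom k H).toCoalgHom (CoalgHom.id k H)).comp
    (Coalgebra.TensorProduct.lid k H).symm.toCoalgHom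

@[simp] lemma tmulOneCoalgHom_apply (x : H) : tmulOneCoalgHom k H x = x ⊗ₜ[k] 1 :=
  congrArg (x ⊗ₜ[k] ·) (map_one (algebraMap k H))

@[simp] lemma oneTmulCoalgHom_apply (x : H) : oneTmulCoalgHom k H x = 1 ⊗ₜ[k] x :=
  congrArg (· ⊗ₜ[k] x) (map_one (algebraMap k H))

/-- If `σ'` defines an associative product on `H` with unit `1`, its convolution inverse `σ` is
a 2-cocycle. -/
theorem isTwoCocycle_of_twistedMul_assoc {σ σ' : H ⊗[k] H →ₗ[k] k}
    (h₁ : conv k σ σ' = convUnit k) (h₂ : conv k σ' σ = convUnit k)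
    (hassoc : twistedMul k H σ' ∘ₗ (twistedMul k H σ').rTensor H =
      twistedMul k H σ' ∘ₗ (twistedMul k H σ').lTensor H ∘ₗ
        (TensorProduct.assoc k H H H).toLinearMap)
    (hl : ∀ x : H, twistedMul k H σ' (1 ⊗ₜ[k] x) = x)
    (hr : ∀ x : H, twistedMul k H σ' (x ⊗ₜ[k] 1) = x) : IsTwoCocycle k H σ := by
  have hinv (h : (H ⊗[k] H) ⊗[k] H →ₗc[k] H ⊗[k] H) :
      conv k (σ ∘ₗ h.toLinearMap) (σ' ∘ₗ h.toLinearMap) = convUnit k ∧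
        conv k (σ' ∘ₗ h.toLinearMap) (σ ∘ₗ h.toLinearMap) = convUnit k := by
    simp only [← conv_comp_coalgHom, h₁, h₂, convUnit_comp_coalgHom, and_self]
  have hunit (h : H →ₗc[k] H ⊗[k] H) (hσ : σ' ∘ₗ h.toLinearMap = counit (R := k)) (x : H) :
      σ (h x) = counit (R := k) x := by
    have hc : (counit (R := k) : H →ₗ[k] k) = convUnit k := by ext; simp [convUnit]
    have h' := conv_comp_coalgHom σ σ' h
    rw [h₁, convUnit_comp_coalgHom, hσ, hc, conv_convUnit, ← hc] at h'
    exact (LinearMap.congr_fun h' x).symm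
  have hε := counit_comp_twistedMul σ'
  have hcocycle : conv k (cocycleL2 k H σ') (cocycleL1 k H σ') =
      conv k (cocycleR2 k H σ') (cocycleR1 k H σ') := by
    rw [conv_cocycleL2_cocycleL1, conv_cocycleR2_cocycleR1]
    have h := congrArg (fun g ↦ counit (R := k) ∘ₗ g) hassoc
    simpa only [← LinearMap.comp_assoc, hε] using h
  refine ⟨⟨σ', h₁, h₂⟩, ?_, fun x ↦ ?_, fun x ↦ ?_⟩
  · simp only [cocycleL1_eq, cocycleL2_eq, cocycleR1_eq, cocycleR2_eq] at hcocycle ⊢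
    exact conv_eq_conv_of_inverse hcocycle (hinv _).1 (hinv _).1 (hinv _).2 (hinv _).2
  · rw [← tmulOneCoalgHom_apply]
    refine hunit _ (LinearMap.ext fun y ↦ ?_) x
    rw [← hε]
    exact congrArg _ ((congrArg _ (tmulOneCoalgHom_apply y)).trans (hr y))
  · rw [← oneTmulCoalgHom_apply]
    refine hunit _ (LinearMap.ext fun y ↦ ?_) x
    rw [← hε]
    exact congrArg _ ((congrArg _ (oneTmulCoalgHom_apply y)).trans (hl y))

end Twist

section TransportedProduct

variable {k : Type u} [CommRing k] {H : Type u} [Ring H] [Bialgebra k H]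
variable {A : Type u} [Ring A] [Algebra k A] {α : A →ₗ[k] H ⊗[k] A}

/-- The product of `A` transported to `H` along a linear isomorphism `H ≃ A`. -/
noncomputable def transportedMul (f : H ≃ₗ[k] A) : H ⊗[k] H →ₗ[k] H :=
  f.symm.toLinearMap ∘ₗ LinearMap.mul' k A ∘ₗ
    TensorProduct.map (f : H →ₗ[k] A) (f : H →ₗ[k] A)

@[simp] lemma transportedMul_tmul (f : H ≃ₗ[k] A) (x y : H) :
    transportedMul f (x ⊗ₜ[k] y) = f.symm (f x * f y) := rfl

lemma comul_comp_transportedMul (hα : IsLeftComoduleAlgebra k H A α) (f : H ≃ₗ[k] A)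
    (hf : IsLeftColinear H (comul (R := k)) α (f : H →ₗ[k] A)) :
    comul (R := k) ∘ₗ transportedMul f =
      TensorProduct.map (LinearMap.mul' k H) (transportedMul f) ∘ₗ comul (R := k) := by
  have hf' (x : H) : (f : H →ₗ[k] A).lTensor H (comul (R := k) x) = α (f x) :=
    (LinearMap.congr_fun hf x).symm
  have hmul (u v : H ⊗[k] H) : (f : H →ₗ[k] A).lTensor H
      (TensorProduct.map (LinearMap.mul' k H) (transportedMul f)
        (TensorProduct.tensorTensorTensorComm k H H H H (u ⊗ₜ v))) =
      (f : H →ₗ[k] A).lTensor H u * (f : H →ₗ[k] A).lTensor H v := by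
    induction u with
    | zero => simp
    | add s t hs ht => simp only [add_tmul, map_add, hs, ht, add_mul]
    | tmul x y =>
      induction v with
      | zero => simp
      | add s t hs ht => simp only [tmul_add, map_add, hs, ht, mul_add]
      | tmul z w => simp
  ext x y
  apply (f.lTensor H).injective
  change (f : H →ₗ[k] A).lTensor H (comul (R := k) (transportedMul f (x ⊗ₜ[k] y))) =
    (f : H →ₗ[k] A).lTensor H (TensorProduct.map (LinearMap.mul' k H) (transportedMul f)
      (TensorProduct.tensorTensorTensorComm k H H H H (comul (R := k) x ⊗ₜ comul (R := k) y)))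
  rw [hf', hmul, hf', hf', transportedMul_tmul, LinearEquiv.apply_symm_apply, hα.map_mul]

lemma transportedMul_assoc (f : H ≃ₗ[k] A) :
    transportedMul f ∘ₗ (transportedMul f).rTensor H = transportedMul f ∘ₗ
      (transportedMul f).lTensor H ∘ₗ (TensorProduct.assoc k H H H).toLinearMap := by
  ext x y z
  simp [mul_assoc]

end TransportedProduct

/-- A unit preserving, colinear and convolution invertible isomorphism `H ≃ A` identifies `A` with
a cocycle twist of `H`. -/
theorem exists_isTwoCocycle {k : Type u} [Field k] {H : Type u} [Ring H] [Bialgebra k H]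
    {A : Type u} [Ring A] [Nontrivial A] [Algebra k A] {α : A →ₗ[k] H ⊗[k] A}
    (hα : IsLeftComoduleAlgebra k H A α) (f : H ≃ₗ[k] A) (hf1 : f 1 = 1)
    (hf : IsLeftColinear H (comul (R := k)) α (f : H →ₗ[k] A))
    (hinv : IsConvInvertible k (f : H →ₗ[k] A)) :
    ∃ σ σ' : H ⊗[k] H →ₗ[k] k, IsTwoCocycle k H σ ∧ conv k σ σ' = convUnit k ∧
      conv k σ' σ = convUnit k ∧
        ∀ x y : H, f (twistedMul k H σ' (x ⊗ₜ[k] y)) = f x * f y := by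
  let σ' : H ⊗[k] H →ₗ[k] k := counit (R := k) ∘ₗ transportedMul f
  have hσ' : twistedMul k H σ' = transportedMul f :=
    twistedMul_counit_comp (comul_comp_transportedMul hα f hf)
  have hmul (x y : H) : f (twistedMul k H σ' (x ⊗ₜ[k] y)) = f x * f y := by simp [hσ']
  have hprod : conv k ((f : H →ₗ[k] A) ∘ₗ LinearMap.mul' k H) (Algebra.linearMap k A ∘ₗ σ') =
      conv k ((f : H →ₗ[k] A) ∘ₗ (fstCoalgHom k H H).toLinearMap)
        ((f : H →ₗ[k] A) ∘ₗ (sndCoalgHom k H H).toLinearMap) := by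
    rw [← comp_twistedMul, conv_comp_fstCoalgHom_comp_sndCoalgHom]
    ext x y
    exact hmul x y
  have hunit : IsConvInvertible k (Algebra.linearMap k A ∘ₗ σ') := by
    have h₁ := (isConvInvertible_iff_isUnit _).1
      (hinv.comp_coalgHom (Bialgebra.mulCoalgHom k H))
    have h₂ := (isConvInvertible_iff_isUnit _).1 (hinv.comp_coalgHom (fstCoalgHom k H H))
    have h₃ := (isConvInvertible_iff_isUnit _).1 (hinv.comp_coalgHom (sndCoalgHom k H H))
    refine (isConvInvertible_iff_isUnit _).2 (h₁.mul_left_iff.1 ?_)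
    exact (congrArg (IsUnit ∘ toConv) hprod).mpr (h₂.mul h₃)
  obtain ⟨σ, h₁, h₂⟩ := isConvInvertible_of_algebraMap_comp hunit
  refine ⟨σ, σ', isTwoCocycle_of_twistedMul_assoc h₂ h₁ ?_ (fun x ↦ ?_) (fun x ↦ ?_), h₂, h₁, hmul⟩
  · rw [hσ', transportedMul_assoc]
  · simp [hσ', hf1]
  · simp [hσ', hf1]

end HopfGalois

/-- For a left `H`-Galois object `A`, TFAE:
(1) there is a 2-cocycle `σ ∈ Z²(H)` with `A ≅ H_{σ⁻¹}` as left `H`-comodule algebras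
(the isomorphism being a unital, multiplicative (for the twisted product) colinear
linear isomorphism);
(2) `A ≅ H` as left `H`-comodules;
(3) there is a convolution invertible `H`-colinear map `φ : H → A`. -/
theorem cleft_tfae (k : Type u) [Field k] (H : Type u) [Ring H] [HopfAlgebra k H]
    (A : Type u) [Ring A] [Algebra k A] (α : A →ₗ[k] H ⊗[k] A)
    (hA : IsLeftGaloisObject k H A α) :
    ((∃ (σ σ' : H ⊗[k] H →ₗ[k] k), IsTwoCocycle k H σ ∧
        conv k σ σ' = convUnit k ∧ conv k σ' σ = convUnit k ∧
        ∃ f : H ≃ₗ[k] A, f 1 = 1 ∧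
          (∀ x y : H, f (twistedMul k H σ' (x ⊗ₜ[k] y)) = f x * f y) ∧
          IsLeftColinear H (Coalgebra.comul (R := k)) α (f : H →ₗ[k] A)) ↔
      (∃ f : H ≃ₗ[k] A, IsLeftColinear H (Coalgebra.comul (R := k)) α (f : H →ₗ[k] A))) ∧
    ((∃ f : H ≃ₗ[k] A, IsLeftColinear H (Coalgebra.comul (R := k)) α (f : H →ₗ[k] A)) ↔
      (∃ φ : H →ₗ[k] A, IsLeftColinear H (Coalgebra.comul (R := k)) α φ ∧
        IsConvInvertible k φ)) := by
  have := hA.nontrivial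
  refine ⟨⟨?_, ?_⟩, ?_, ?_⟩
  · rintro ⟨σ, σ', -, -, -, f, -, -, hf⟩
    exact ⟨f, hf⟩
  · rintro ⟨f, hf⟩
    obtain ⟨g, hg1, hg⟩ := hA.exists_colinear_map_one f hf
    obtain ⟨σ, σ', hσ, h₁, h₂, hmul⟩ := exists_isTwoCocycle hA.comodAlg g hg1 hg
      ((hA.bijective_iff_isConvInvertible hg).1 g.bijective)
    exact ⟨σ, σ', hσ, h₁, h₂, g, hg1, hmul, hg⟩
  · rintro ⟨f, hf⟩
    exact ⟨f, hf, (hA.bijective_iff_isConvInvertible hf).1 f.bijective⟩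
  · rintro ⟨φ, hφ, hinv⟩
    exact ⟨LinearEquiv.ofBijective φ ((hA.bijective_iff_isConvInvertible hφ).2 hinv), hφ⟩
end

section
/- Let H be a Hopf algebra over a field k which is either finite-dimensional or pointed (all its simple comodules are 1-dimensional). Then every H-Galois object is cleft, i.e. isomorphic to H as an H-comodule. -/
open TensorProduct

universe u

namespace HopfGalois

variable (k : Type u) [CommRing k] (H : Type u) [Ring H] [Bialgebra k H]

/-- A subspace `W` of a right `H`-comodule is a subcomodule if the coaction maps it
into (the image of) `W ⊗ H`. -/
def IsSubcomodule {V : Type u} [AddCommGroup V] [Module k V]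
    (ρ : V →ₗ[k] V ⊗[k] H) (W : Submodule k V) : Prop :=
  ∀ w ∈ W, ρ w ∈ LinearMap.range (W.subtype.rTensor H)

/-- A right `H`-comodule is simple if it is nonzero and has no nontrivial subcomodules. -/
def IsSimpleComodule {V : Type u} [AddCommGroup V] [Module k V]
    (ρ : V →ₗ[k] V ⊗[k] H) : Prop :=
  Nontrivial V ∧ ∀ W : Submodule k V, IsSubcomodule k H ρ W → W = ⊥ ∨ W = ⊤

/-- A Hopf algebra is pointed if all its simple (right) comodules are 1-dimensional. -/
def IsPointed : Prop :=
  ∀ (V : Type u) [AddCommGroup V] [Module k V] (ρ : V →ₗ[k] V ⊗[k] H),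
    IsRightCoaction k H ρ → IsSimpleComodule k H ρ → Module.rank k V = 1

end HopfGalois

open HopfGalois

namespace HopfGalois

open Submodule in
theorem simple_le_of_maximal {k R M N : Type*} [Field k] [Ring R] [Algebra k R]
    [AddCommGroup M] [Module k M] [Module R M] [IsScalarTower k R M]
    [AddCommGroup N] [Module k N] [Module R N] [IsScalarTower k R N]
    {Γ : Submodule R (M × N)} (hΓ : ∀ p ∈ Γ, p.1 = 0 ↔ p.2 = 0)
    (hmax : ∀ Γ' : Submodule R (M × N), (∀ p ∈ Γ', p.1 = 0 ↔ p.2 = 0) → Γ ≤ Γ' → Γ' ≤ Γ)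
    (S : Submodule R M) [IsSimpleModule R S]
    (hpos : 0 < Module.finrank k (S →ₗ[R] M))
    (heq : Module.finrank k (S →ₗ[R] N) = Module.finrank k (S →ₗ[R] M)) :
    S ≤ Γ.map (LinearMap.fst R M N) := by
  by_contra hS
  have : Module.Finite k (S →ₗ[R] M) := Module.finite_of_finrank_pos hpos
  have hdisj : ∀ s : M, s ∈ S → ∀ q : N, (s, q) ∈ Γ → s = 0 := by
    have hat : IsAtom S := isSimpleModule_iff_isAtom.mp inferInstance
    have := hat.not_le_iff_disjoint.mp hS
    intro s hs q hq
    exact (Submodule.disjoint_def.mp this) s hs ⟨_, hq, rfl⟩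
  let p₁ : Γ →ₗ[R] M := LinearMap.fst R M N ∘ₗ Γ.subtype
  let p₂ : Γ →ₗ[R] N := LinearMap.snd R M N ∘ₗ Γ.subtype
  have hp₂ : Function.Injective p₂ := by
    rw [← LinearMap.ker_eq_bot, LinearMap.ker_eq_bot']
    rintro ⟨p, hp⟩ h
    exact Subtype.ext (Prod.ext ((hΓ p hp).mpr h) h)
  have hp₁ : Function.Injective p₁ := by
    rw [← LinearMap.ker_eq_bot, LinearMap.ker_eq_bot']
    rintro ⟨p, hp⟩ h
    exact Subtype.ext (Prod.ext h ((hΓ p hp).mp h))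
  have hj : ∀ j : S →ₗ[R] N, ∀ s, j s ∈ LinearMap.range p₂ := by
    intro j
    by_contra! hcon
    obtain ⟨s₀, hs₀⟩ := hcon
    have hj0 : j ≠ 0 := by
      rintro rfl
      exact hs₀ (zero_mem _)
    have hinj : Function.Injective j := (LinearMap.injective_or_eq_zero j).resolve_right hj0
    have hbot : (LinearMap.range p₂).comap j = ⊥ :=
      (eq_bot_or_eq_top _).resolve_right fun h ↦ hs₀ (h ▸ mem_top : s₀ ∈ (LinearMap.range p₂).comap j)
    let G : Submodule R (M × N) := LinearMap.range (S.subtype.prod j)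
    have hle : Γ ⊔ G ≤ Γ := by
      refine hmax _ ?_ le_sup_left
      intro p hp
      obtain ⟨⟨x, y⟩, hx, _, ⟨s, rfl⟩, rfl⟩ := Submodule.mem_sup.mp hp
      change x + s = 0 ↔ y + j s = 0
      constructor
      · intro h
        have h1 : (s : M) = 0 := by
          refine hdisj s s.2 (-y) ?_
          have h2 : (s : M) = -x := by rw [eq_neg_iff_add_eq_zero, add_comm]; exact h
          rw [h2]
          exact Γ.neg_mem hx
        have h3 : s = 0 := Subtype.ext h1
        subst h3
        have := (hΓ _ hx).mp (by simpa using h)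
        simpa using this
      · intro h
        have h2 : j s = -y := by rw [eq_neg_iff_add_eq_zero, add_comm]; exact h
        have h3 : s ∈ (LinearMap.range p₂).comap j :=
          ⟨⟨-(x, y), Γ.neg_mem hx⟩, by simp [p₂, h2]⟩
        rw [hbot, mem_bot] at h3
        subst h3
        have := (hΓ _ hx).mpr (by simpa using h)
        simpa using this
    refine hs₀ ⟨⟨(s₀, j s₀), hle (mem_sup_right ⟨s₀, rfl⟩)⟩, rfl⟩
  let e := (LinearEquiv.ofInjective p₂ hp₂).symm
  let Θ : (S →ₗ[R] N) →ₗ[k] (S →ₗ[R] M) :=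
    { toFun := fun j ↦ p₁ ∘ₗ e.toLinearMap ∘ₗ j.codRestrict _ (hj j)
      map_add' := fun j j' ↦ by
        ext s
        simp only [LinearMap.comp_apply, LinearMap.add_apply, ← map_add]
        rfl
      map_smul' := fun c j ↦ by
        ext s
        simp only [LinearMap.comp_apply, LinearMap.smul_apply, RingHom.id_apply]
        rw [← LinearMap.map_smul_of_tower, ← LinearMap.map_smul_of_tower]
        rfl }
  have hΘ : Function.Injective Θ := by
    intro j j' h
    ext s
    have h1 := hp₁ (LinearMap.congr_fun h s)
    simpa using congrArg Subtype.val (e.injective h1)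
  have : Module.Finite k (S →ₗ[R] N) := Module.finite_of_finrank_pos (heq ▸ hpos)
  obtain ⟨j, hj'⟩ := (LinearMap.injective_iff_surjective_of_finrank_eq_finrank heq).mp hΘ S.subtype
  refine hS fun s hs ↦ ?_
  have := LinearMap.congr_fun hj' ⟨s, hs⟩
  exact ⟨_, (e (j.codRestrict _ (hj j) ⟨s, hs⟩)).2, this⟩

open Submodule in
theorem nonempty_linearEquiv_of_finrank_eq {k R M N : Type*} [Field k] [Ring R] [Algebra k R]
    [AddCommGroup M] [Module k M] [Module R M] [IsScalarTower k R M]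
    [AddCommGroup N] [Module k N] [Module R N] [IsScalarTower k R N]
    (atomM : ∀ U : Submodule R M, U ≠ ⊥ → ∃ S ≤ U, IsSimpleModule R S)
    (atomN : ∀ U : Submodule R N, U ≠ ⊥ → ∃ S ≤ U, IsSimpleModule R S)
    (extM : ∀ (U : Submodule R M) (f : U →ₗ[R] N), ∃ F : M →ₗ[R] N, F ∘ₗ U.subtype = f)
    (extN : ∀ (U : Submodule R N) (f : U →ₗ[R] M), ∃ F : N →ₗ[R] M, F ∘ₗ U.subtype = f)
    (rankM : ∀ S : Submodule R M, IsSimpleModule R S → 0 < Module.finrank k (S →ₗ[R] M) ∧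
      Module.finrank k (S →ₗ[R] N) = Module.finrank k (S →ₗ[R] M))
    (rankN : ∀ S : Submodule R N, IsSimpleModule R S → 0 < Module.finrank k (S →ₗ[R] N) ∧
      Module.finrank k (S →ₗ[R] M) = Module.finrank k (S →ₗ[R] N)) :
    Nonempty (M ≃ₗ[R] N) := by
  obtain ⟨Γ, hΓ⟩ : ∃ Γ, Maximal (fun Γ : Submodule R (M × N) ↦ ∀ p ∈ Γ, p.1 = 0 ↔ p.2 = 0) Γ := by
    refine zorn_le₀ {Γ : Submodule R (M × N) | ∀ p ∈ Γ, p.1 = 0 ↔ p.2 = 0} fun c hc hchain ↦ ?_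
    rcases c.eq_empty_or_nonempty with rfl | hne
    · exact ⟨⊥, by simp, by simp⟩
    refine ⟨sSup c, fun p hp ↦ ?_, fun _ ↦ le_sSup⟩
    obtain ⟨Γ, hΓ, hpΓ⟩ := (Submodule.mem_sSup_of_directed hne hchain.directedOn).mp hp
    exact hc hΓ p hpΓ
  have hS₁ : ∀ S : Submodule R M, IsSimpleModule R S → S ≤ Γ.map (LinearMap.fst R M N) :=
    fun S hS ↦ simple_le_of_maximal (k := k) hΓ.prop (fun _ h h' ↦ hΓ.le_of_ge h h') S
      (rankM S hS).1 (rankM S hS).2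
  have hS₂ : ∀ S : Submodule R N, IsSimpleModule R S → S ≤ Γ.map (LinearMap.snd R M N) := by
    intro S hS x hx
    have := simple_le_of_maximal (k := k)
      (Γ := Γ.comap (LinearEquiv.prodComm R N M).toLinearMap)
      (fun p hp ↦ (hΓ.prop _ hp).symm) (fun Γ' h h' p hp ↦ ?_) S (rankN S hS).1 (rankN S hS).2
    · obtain ⟨p, hp, rfl⟩ := this hx
      exact ⟨p.swap, hp, rfl⟩
    · refine hΓ.le_of_ge (y := Γ'.comap (LinearEquiv.prodComm R M N).toLinearMap)
        (fun p hp ↦ (h _ hp).symm) (fun p hp ↦ h' ?_) (show p.swap ∈ _ from hp)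
      exact hp
  let p₁ : Γ →ₗ[R] M := LinearMap.fst R M N ∘ₗ Γ.subtype
  let p₂ : Γ →ₗ[R] N := LinearMap.snd R M N ∘ₗ Γ.subtype
  have hp₁ : Function.Injective p₁ := by
    rw [← LinearMap.ker_eq_bot, LinearMap.ker_eq_bot']
    rintro ⟨p, hp⟩ h
    exact Subtype.ext (Prod.ext h ((hΓ.prop p hp).mp h))
  obtain ⟨F, hF⟩ := extM _ (p₂ ∘ₗ (LinearEquiv.ofInjective p₁ hp₁).symm.toLinearMap)
  have hFΓ : ∀ p ∈ Γ, F p.1 = p.2 := by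
    intro p hp
    have := LinearMap.congr_fun hF (LinearEquiv.ofInjective p₁ hp₁ ⟨p, hp⟩)
    simpa [p₁, p₂] using this
  have hFinj : Function.Injective F := by
    rw [← LinearMap.ker_eq_bot]
    by_contra hne
    obtain ⟨S, hS, hsimple⟩ := atomM _ hne
    have := IsSimpleModule.nontrivial R S
    obtain ⟨⟨s, hs⟩, hs0⟩ := exists_ne (0 : S)
    obtain ⟨p, hp, rfl⟩ := hS₁ S hsimple hs
    exact hs0 (Subtype.ext ((hΓ.prop p hp).mpr (hFΓ p hp ▸ hS hs)))
  obtain ⟨G, hG⟩ := extN _ (LinearEquiv.ofInjective F hFinj).symm.toLinearMap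
  have hGF : ∀ x, G (F x) = x := by
    intro x
    have := LinearMap.congr_fun hG (LinearEquiv.ofInjective F hFinj x)
    simpa using this
  have hGinj : Function.Injective G := by
    rw [← LinearMap.ker_eq_bot]
    by_contra hne
    obtain ⟨S, hS, hsimple⟩ := atomN _ hne
    have := IsSimpleModule.nontrivial R S
    obtain ⟨⟨s, hs⟩, hs0⟩ := exists_ne (0 : S)
    obtain ⟨p, hp, rfl⟩ := hS₂ S hsimple hs
    refine hs0 (Subtype.ext ((hΓ.prop p hp).mp ?_))
    have := hS hs
    rw [LinearMap.snd_apply, ← hFΓ p hp, LinearMap.mem_ker, hGF] at this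
    exact this
  exact ⟨(LinearEquiv.ofBijective G ⟨hGinj, fun x ↦ ⟨F x, hGF x⟩⟩).symm⟩

theorem isSimpleModule_map_subtype {R M : Type*} [Ring R] [AddCommGroup M] [Module R M]
    (C : Submodule R M) (S : Submodule R C) [IsSimpleModule R S] :
    IsSimpleModule R (S.map C.subtype) :=
  IsSimpleModule.congr (S.equivMapOfInjective C.subtype C.injective_subtype).symm

section Comodules

variable {k : Type u} [Field k] {H : Type u} [Ring H] [Bialgebra k H]
variable {V : Type u} [AddCommGroup V] [Module k V]
variable {W : Type u} [AddCommGroup W] [Module k W]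

/-- Contraction of the left tensor factor with a functional. -/
noncomputable def contract {M : Type u} [AddCommGroup M] [Module k M] (φ : Module.Dual k M)
    (X : Type u) [AddCommGroup X] [Module k X] :
    M ⊗[k] X →ₗ[k] X :=
  (TensorProduct.lid k X).toLinearMap ∘ₗ φ.rTensor X

section Contract

variable {M X Y : Type u} [AddCommGroup M] [Module k M] [AddCommGroup X] [Module k X]
  [AddCommGroup Y] [Module k Y]

@[simp]
theorem contract_tmul (φ : Module.Dual k M) (h : M) (x : X) :
    contract φ X (h ⊗ₜ x) = φ h • x := by
  simp [contract]

theorem contract_lTensor (φ : Module.Dual k M) (f : X →ₗ[k] Y) (t : M ⊗[k] X) :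
    contract φ Y (f.lTensor M t) = f (contract φ X t) := by
  induction t with
  | zero => simp
  | tmul h x => simp
  | add s t hs ht => simp only [map_add, hs, ht]

/-- Elements of `M ⊗ X` are separated by contractions. -/
theorem eq_of_contract_eq {s t : M ⊗[k] X}
    (h : ∀ φ : Module.Dual k M, contract φ X s = contract φ X t) : s = t := by
  classical
  let b := Module.Basis.ofVectorSpace k M
  apply (TensorProduct.equivFinsuppOfBasisLeft (N := X) b).injective
  ext i
  have key : ∀ t : M ⊗[k] X, TensorProduct.equivFinsuppOfBasisLeft b t i
      = contract (b.coord i) X t := by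
    intro t
    induction t with
    | zero => simp
    | tmul h x => simp
    | add s t hs ht => simp only [map_add, Finsupp.add_apply, hs, ht]
  rw [key, key, h]

end Contract

/-- The operator on a left comodule given by acting with a functional. -/
noncomputable def dualAct (lam : V →ₗ[k] H ⊗[k] V) : Module.Dual k H →ₗ[k] Module.End k V where
  toFun φ := contract φ V ∘ₗ lam
  map_add' φ ψ := by
    ext v
    simp [contract, LinearMap.rTensor_add]
  map_smul' c φ := by
    ext v
    simp [contract, LinearMap.rTensor_smul]

theorem dualAct_apply (lam : V →ₗ[k] H ⊗[k] V) (φ : Module.Dual k H) (v : V) :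
    dualAct lam φ v = contract φ V (lam v) := rfl

theorem contract_counit {lam : V →ₗ[k] H ⊗[k] V} (h : IsLeftCoaction k H lam) (v : V) :
    contract (Coalgebra.counit (R := k) (A := H)) V (lam v) = v :=
  LinearMap.congr_fun h.counit v

theorem dualAct_dualAct {lam : V →ₗ[k] H ⊗[k] V} (h : IsLeftCoaction k H lam)
    (φ ψ : Module.Dual k H) (v : V) :
    dualAct lam ψ (dualAct lam φ v) =
      dualAct lam (LinearMap.mul' k k ∘ₗ TensorProduct.map φ ψ ∘ₗ Coalgebra.comul) v := by
  have h1 : dualAct lam ψ (dualAct lam φ v)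
      = contract ψ V (contract φ (H ⊗[k] V) (lam.lTensor H (lam v))) := by
    rw [contract_lTensor]
    rfl
  have h2 := LinearMap.congr_fun h.coassoc v
  simp only [LinearMap.comp_apply] at h2
  rw [h1, h2, dualAct_apply]
  generalize lam v = t
  induction t with
  | zero => simp
  | add s t hs ht => simp only [map_add, hs, ht]
  | tmul h x =>
    simp only [LinearMap.rTensor_tmul, contract_tmul, LinearMap.comp_apply]
    generalize Coalgebra.comul (R := k) h = d
    induction d with
    | zero => simp
    | add s t hs ht => simp only [map_add, TensorProduct.add_tmul, add_smul, hs, ht]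
    | tmul a b => simp [mul_smul]

variable (k H) in
/-- The ring acting on left `H`-comodules: its action records the operators `dualAct`. -/
abbrev ActRing := FreeAlgebra k (Module.Dual k H)

/-- The `ActRing`-module structure on `V` comes from the coaction `lam`. -/
structure IsComoduleAction [Module (ActRing k H) V] (lam : V →ₗ[k] H ⊗[k] V) : Prop where
  coaction : IsLeftCoaction k H lam
  smul_eq : ∀ (φ : Module.Dual k H) (v : V), FreeAlgebra.ι k φ • v = dualAct lam φ v

/-- The `ActRing`-module structure on a left comodule. -/
noncomputable abbrev actModule (lam : V →ₗ[k] H ⊗[k] V) : Module (ActRing k H) V :=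
  Module.compHom V (FreeAlgebra.lift k (dualAct lam : Module.Dual k H → Module.End k V)).toRingHom

theorem isScalarTower_actModule (lam : V →ₗ[k] H ⊗[k] V) :
    letI := actModule lam
    IsScalarTower k (ActRing k H) V := by
  let := actModule lam
  refine IsScalarTower.of_algebraMap_smul fun c v ↦ ?_
  change FreeAlgebra.lift k (dualAct lam : Module.Dual k H → Module.End k V)
    (algebraMap k _ c) v = c • v
  rw [AlgHom.commutes]
  rfl

theorem isComoduleAction_actModule {lam : V →ₗ[k] H ⊗[k] V} (h : IsLeftCoaction k H lam) :
    letI := actModule lam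
    IsComoduleAction lam := by
  let := actModule lam
  refine ⟨h, fun φ v ↦ ?_⟩
  change FreeAlgebra.lift k (dualAct lam : Module.Dual k H → Module.End k V)
    (FreeAlgebra.ι k φ) v = _
  rw [FreeAlgebra.lift_ι_apply]

variable [Module (ActRing k H) V] [IsScalarTower k (ActRing k H) V]
variable [Module (ActRing k H) W] [IsScalarTower k (ActRing k H) W]
variable {lam : V →ₗ[k] H ⊗[k] V} {mu : W →ₗ[k] H ⊗[k] W}

/-- `ActRing`-linear maps are colinear. -/
theorem isLeftColinear_of_linear (hV : IsComoduleAction lam) (hW : IsComoduleAction mu)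
    (f : V →ₗ[ActRing k H] W) : IsLeftColinear H lam mu (f.restrictScalars k) := by
  ext v
  refine eq_of_contract_eq fun φ ↦ ?_
  simp only [LinearMap.comp_apply]
  rw [contract_lTensor, ← dualAct_apply, ← dualAct_apply, ← hW.smul_eq, ← hV.smul_eq]
  simp

/-- Colinear maps are `ActRing`-linear. -/
def linearOfColinear (hV : IsComoduleAction lam) (hW : IsComoduleAction mu)
    (f : V →ₗ[k] W) (hf : IsLeftColinear H lam mu f) : V →ₗ[ActRing k H] W where
  toFun := f
  map_add' := f.map_add
  map_smul' r v := by
    induction r using FreeAlgebra.induction generalizing v with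
    | grade0 c => simp
    | grade1 φ =>
      rw [RingHom.id_apply, hV.smul_eq, hW.smul_eq, dualAct_apply, dualAct_apply,
        ← contract_lTensor]
      exact congrArg _ (LinearMap.congr_fun hf v).symm
    | mul a b ha hb =>
      simp only [RingHom.id_apply] at ha hb ⊢
      rw [mul_smul, ha, hb, mul_smul]
    | add a b ha hb =>
      simp only [RingHom.id_apply] at ha hb ⊢
      rw [add_smul, map_add, ha, hb, add_smul]

@[simp]
theorem linearOfColinear_apply (hV : IsComoduleAction lam) (hW : IsComoduleAction mu)
    (f : V →ₗ[k] W) (hf : IsLeftColinear H lam mu f) (v : V) :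
    linearOfColinear hV hW f hf v = f v := rfl

/-- A submodule of a comodule is a comodule. -/
theorem exists_isComoduleAction_submodule (hV : IsComoduleAction lam)
    (S : Submodule (ActRing k H) V) :
    ∃ lamS : S →ₗ[k] H ⊗[k] S, IsComoduleAction lamS ∧
      IsLeftColinear H lamS lam (S.subtype.restrictScalars k) := by
  let i : S →ₗ[k] V := S.subtype.restrictScalars k
  have hi : Function.Injective i := Subtype.val_injective
  have hinj : ∀ {X Y : Type u} [AddCommGroup X] [Module k X] [AddCommGroup Y] [Module k Y]
      {f : X →ₗ[k] Y}, Function.Injective f → Function.Injective (f.lTensor H) :=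
    fun hf ↦ Module.Flat.lTensor_preserves_injective_linearMap _ hf
  have hmem : ∀ s : S, lam s ∈ LinearMap.range (i.lTensor H) := by
    intro s
    obtain ⟨p, hp⟩ := i.exists_leftInverse_of_injective (LinearMap.ker_eq_bot.mpr hi)
    refine ⟨p.lTensor H (lam s), eq_of_contract_eq fun φ ↦ ?_⟩
    rw [contract_lTensor, contract_lTensor, ← dualAct_apply, ← hV.smul_eq]
    have := LinearMap.congr_fun hp (FreeAlgebra.ι k φ • s)
    exact congrArg i this
  let lamS : S →ₗ[k] H ⊗[k] S :=
    (LinearEquiv.ofInjective _ (hinj hi)).symm.toLinearMap ∘ₗ (lam ∘ₗ i).codRestrict _ hmem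
  have hcol : ∀ s, i.lTensor H (lamS s) = lam (i s) := fun s ↦
    congrArg Subtype.val ((LinearEquiv.ofInjective _ (hinj hi)).apply_symm_apply _)
  have hcol' : i.lTensor H ∘ₗ lamS = lam ∘ₗ i := LinearMap.ext hcol
  refine ⟨lamS, ⟨⟨?_, ?_⟩, fun φ s ↦ ?_⟩, LinearMap.ext fun s ↦ (hcol s).symm⟩
  · ext s
    apply hinj (hinj hi)
    have h1 := LinearMap.congr_fun hV.coaction.coassoc (i s)
    simp only [LinearMap.comp_apply] at h1 ⊢
    rw [← LinearMap.comp_apply, ← LinearMap.lTensor_comp, hcol', LinearMap.lTensor_comp,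
      LinearMap.comp_apply, hcol, h1, ← hcol]
    generalize lamS s = t
    induction t with
    | zero => simp
    | add s t hs ht => simp only [map_add, hs, ht]
    | tmul h x =>
      simp only [LinearMap.rTensor_tmul, LinearMap.lTensor_tmul]
      generalize Coalgebra.comul (R := k) h = d
      induction d with
      | zero => simp
      | add s t hs ht => simp only [map_add, TensorProduct.add_tmul, hs, ht]
      | tmul a b => simp
  · ext s
    change i (contract _ _ (lamS s)) = i s
    rw [← contract_lTensor, hcol]
    exact contract_counit hV.coaction _
  · apply hi
    rw [dualAct_apply, ← contract_lTensor, hcol]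
    exact hV.smul_eq φ s

/-- Cyclic subcomodules are finite-dimensional. -/
theorem finite_span_singleton (hV : IsComoduleAction lam) (v : V) :
    Module.Finite k (Submodule.span (ActRing k H) {v}) := by
  let P : Submodule k V := LinearMap.range ((dualAct lam).flip v)
  have hP : Module.Finite k P := by
    obtain ⟨Q, hQ, hv⟩ := TensorProduct.exists_finite_submodule_right_of_setFinite
      {lam v} (Set.finite_singleton _)
    have : P ≤ Q := by
      rintro _ ⟨φ, rfl⟩
      obtain ⟨t, ht⟩ := hv rfl
      rw [LinearMap.flip_apply, dualAct_apply, ← ht, contract_lTensor]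
      exact Subtype.property _
    exact Submodule.finiteDimensional_of_le this
  have hstab : ∀ (r : ActRing k H), ∀ w ∈ P, r • w ∈ P := by
    intro r
    induction r using FreeAlgebra.induction with
    | grade0 c =>
      intro w hw
      rw [algebraMap_smul]
      exact P.smul_mem c hw
    | grade1 φ =>
      rintro _ ⟨ψ, rfl⟩
      rw [hV.smul_eq, LinearMap.flip_apply, dualAct_dualAct hV.coaction]
      exact ⟨_, rfl⟩
    | mul a b ha hb =>
      intro w hw
      rw [mul_smul]
      exact ha _ (hb _ hw)
    | add a b ha hb =>
      intro w hw
      rw [add_smul]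
      exact P.add_mem (ha _ hw) (hb _ hw)
  have hvP : v ∈ P := ⟨_, contract_counit hV.coaction v⟩
  have hle : (Submodule.span (ActRing k H) {v}).restrictScalars k ≤ P := by
    intro w hw
    obtain ⟨r, rfl⟩ := Submodule.mem_span_singleton.mp hw
    exact hstab r v hvP
  exact Submodule.finiteDimensional_of_le hle

theorem finite_of_isSimpleModule (hV : IsComoduleAction lam) [IsSimpleModule (ActRing k H) V] :
    Module.Finite k V := by
  have := IsSimpleModule.nontrivial (ActRing k H) V
  obtain ⟨v, hv⟩ := exists_ne (0 : V)
  have hfin := finite_span_singleton hV v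
  rw [IsSimpleModule.span_singleton_eq_top (ActRing k H) hv] at hfin
  exact Module.Finite.equiv ((Submodule.topEquiv (R := ActRing k H) (M := V)).restrictScalars k)

theorem exists_isSimpleModule_le (hV : IsComoduleAction lam) (U : Submodule (ActRing k H) V)
    (hU : U ≠ ⊥) : ∃ S ≤ U, IsSimpleModule (ActRing k H) S := by
  obtain ⟨v, hvU, hv⟩ := U.exists_mem_ne_zero_of_ne_bot hU
  let C := Submodule.span (ActRing k H) {v}
  have hfin : Module.Finite k C := finite_span_singleton hV v
  have : IsArtinian (ActRing k H) C := isArtinian_of_tower k inferInstance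
  have : Nontrivial C :=
    ⟨⟨v, Submodule.mem_span_singleton_self v⟩, 0, fun h ↦ hv (congrArg Subtype.val h)⟩
  obtain ⟨S, hS⟩ := IsAtomic.exists_atom (Submodule (ActRing k H) C)
  have hsimple : IsSimpleModule (ActRing k H) S := isSimpleModule_iff_isAtom.mpr hS
  refine ⟨S.map C.subtype, ?_, ?_⟩
  · rintro _ ⟨s, -, rfl⟩
    exact (Submodule.span_singleton_le_iff_mem v U).mpr hvU s.2
  · exact isSimpleModule_map_subtype C S

end Comodules

section Regular

variable {k : Type u} [Field k] {H : Type u} [Ring H] [Bialgebra k H]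
variable {V : Type u} [AddCommGroup V] [Module k V]

variable (k H) in
theorem isLeftCoaction_comul : IsLeftCoaction k H (Coalgebra.comul (R := k) (A := H)) where
  coassoc := Coalgebra.coassoc.symm
  counit := by
    rw [Coalgebra.rTensor_counit_comp_comul]
    ext
    simp

/-- The map into `H` cofreely induced by a functional on a comodule. -/
noncomputable def cofree (lam : V →ₗ[k] H ⊗[k] V) (μ : Module.Dual k V) : V →ₗ[k] H :=
  (TensorProduct.rid k H).toLinearMap ∘ₗ μ.lTensor H ∘ₗ lam

theorem isLeftColinear_cofree {lam : V →ₗ[k] H ⊗[k] V} (h : IsLeftCoaction k H lam)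
    (μ : Module.Dual k V) : IsLeftColinear H lam Coalgebra.comul (cofree lam μ) := by
  ext v
  have h1 := LinearMap.congr_fun h.coassoc v
  simp only [LinearMap.comp_apply] at h1
  simp only [LinearMap.comp_apply, cofree, LinearMap.lTensor_comp]
  rw [h1]
  generalize lam v = t
  induction t with
  | zero => simp
  | add s t hs ht => simp only [map_add, hs, ht]
  | tmul h x =>
    simp only [LinearMap.rTensor_tmul, LinearMap.lTensor_tmul, LinearEquiv.coe_coe,
      TensorProduct.rid_tmul, map_smul]
    generalize Coalgebra.comul (R := k) h = d
    induction d with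
    | zero => simp
    | add s t hs ht => simp only [map_add, TensorProduct.add_tmul, smul_add, hs, ht]
    | tmul a b => simp

theorem counit_cofree {lam : V →ₗ[k] H ⊗[k] V} (h : IsLeftCoaction k H lam)
    (μ : Module.Dual k V) (v : V) :
    Coalgebra.counit (R := k) (cofree lam μ v) = μ v := by
  conv_rhs => rw [← contract_counit h v]
  simp only [cofree, LinearMap.comp_apply]
  generalize lam v = t
  induction t with
  | zero => simp
  | add s t hs ht => simp only [map_add, hs, ht]
  | tmul h x => simp [mul_comm]

theorem eq_cofree {lam : V →ₗ[k] H ⊗[k] V} (f : V →ₗ[k] H)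
    (hf : IsLeftColinear H lam Coalgebra.comul f) :
    f = cofree lam (Coalgebra.counit (R := k) ∘ₗ f) := by
  ext v
  have h1 := LinearMap.congr_fun hf v
  simp only [LinearMap.comp_apply] at h1
  simp only [cofree, LinearMap.comp_apply, LinearMap.lTensor_comp]
  rw [← h1]
  simp

variable [Module (ActRing k H) V] [IsScalarTower k (ActRing k H) V]
variable [Module (ActRing k H) H] [IsScalarTower k (ActRing k H) H]
variable {lam : V →ₗ[k] H ⊗[k] V}

/-- Comodule maps into `H` are the same as functionals. -/
noncomputable def homRegularEquiv (hV : IsComoduleAction lam)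
    (hH : IsComoduleAction (Coalgebra.comul (R := k) (A := H))) :
    (V →ₗ[ActRing k H] H) ≃ₗ[k] Module.Dual k V where
  toFun f := Coalgebra.counit ∘ₗ f.restrictScalars k
  map_add' f g := by ext; simp
  map_smul' c f := by ext; simp
  invFun μ := linearOfColinear hV hH _ (isLeftColinear_cofree hV.coaction μ)
  left_inv f := by
    ext v
    exact (LinearMap.congr_fun (eq_cofree _ (isLeftColinear_of_linear hV hH f)) v).symm
  right_inv μ := LinearMap.ext fun v ↦ counit_cofree hV.coaction μ v

theorem finrank_hom_regular (hV : IsComoduleAction lam)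
    (hH : IsComoduleAction (Coalgebra.comul (R := k) (A := H))) :
    Module.finrank k (V →ₗ[ActRing k H] H) = Module.finrank k V := by
  rw [(homRegularEquiv hV hH).finrank_eq, Subspace.dual_finrank_eq]

theorem exists_extend_regular (hV : IsComoduleAction lam)
    (hH : IsComoduleAction (Coalgebra.comul (R := k) (A := H)))
    (U : Submodule (ActRing k H) V) (f : U →ₗ[ActRing k H] H) :
    ∃ F : V →ₗ[ActRing k H] H, F ∘ₗ U.subtype = f := by
  obtain ⟨lamU, hU, -⟩ := exists_isComoduleAction_submodule hV U
  obtain ⟨p, hp⟩ := (U.subtype.restrictScalars k).exists_leftInverse_of_injective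
    (LinearMap.ker_eq_bot.mpr Subtype.val_injective)
  refine ⟨(homRegularEquiv hV hH).symm (homRegularEquiv hU hH f ∘ₗ p), ?_⟩
  apply (homRegularEquiv hU hH).injective
  ext u
  have h1 := LinearMap.congr_fun
    ((homRegularEquiv hV hH).apply_symm_apply (homRegularEquiv hU hH f ∘ₗ p)) (u : V)
  refine h1.trans ?_
  exact congrArg (homRegularEquiv hU hH f) (LinearMap.congr_fun hp u)

end Regular

section Galois

variable {k : Type u} [Field k] {H : Type u} [Ring H]
variable {A : Type u} [Ring A] [Algebra k A]

/-- Contraction of the right tensor factor of `A ⊗ A` with a functional. -/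
noncomputable def slice (ν : Module.Dual k A) : A ⊗[k] A →ₗ[k] A :=
  contract ν A ∘ₗ (TensorProduct.comm k A A).toLinearMap

@[simp]
theorem slice_tmul (ν : Module.Dual k A) (a b : A) : slice ν (a ⊗ₜ b) = ν b • a := by
  simp [slice]

theorem eq_of_slice_eq {s t : A ⊗[k] A} (h : ∀ ν : Module.Dual k A, slice ν s = slice ν t) :
    s = t :=
  (TensorProduct.comm k A A).injective (eq_of_contract_eq h)

variable [Bialgebra k H]
variable {V : Type u} [AddCommGroup V] [Module k V]
variable {α : A →ₗ[k] H ⊗[k] A} {lam : V →ₗ[k] H ⊗[k] V}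

theorem leftCanonicalMap_tmul (a b : A) :
    leftCanonicalMap k H A α (a ⊗ₜ b) = α a * (1 ⊗ₜ b) := by
  simp only [leftCanonicalMap, LinearMap.comp_apply, LinearMap.rTensor_tmul]
  generalize α a = t
  induction t with
  | zero => simp
  | add s t hs ht => simp only [TensorProduct.add_tmul, map_add, add_mul, hs, ht]
  | tmul h x => simp

theorem leftCanonicalMap_mul (t : A ⊗[k] A) (c : A) :
    leftCanonicalMap k H A α (t * (1 ⊗ₜ c)) = leftCanonicalMap k H A α t * (1 ⊗ₜ c) := by
  induction t with
  | zero => simp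
  | add s t hs ht => simp only [map_add, add_mul, hs, ht]
  | tmul a b =>
    rw [Algebra.TensorProduct.tmul_mul_tmul, mul_one, leftCanonicalMap_tmul, leftCanonicalMap_tmul,
      mul_assoc, Algebra.TensorProduct.tmul_mul_tmul, mul_one]

theorem contract_leftCanonicalMap (hα : IsLeftCoaction k H α) (t : A ⊗[k] A) :
    contract (Coalgebra.counit (R := k)) A (leftCanonicalMap k H A α t) = LinearMap.mul' k A t := by
  induction t with
  | zero => simp
  | add s t hs ht => simp only [map_add, hs, ht]
  | tmul a b =>
    rw [leftCanonicalMap_tmul, LinearMap.mul'_apply]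
    conv_rhs => rw [← contract_counit hα a]
    generalize α a = t
    induction t with
    | zero => simp
    | add s t hs ht => simp only [map_add, add_mul, hs, ht]
    | tmul h x => simp

theorem lTensor_leftCanonicalMap (hα : IsLeftCoaction k H α) (t : A ⊗[k] A) :
    (leftCanonicalMap k H A α).lTensor H (TensorProduct.assoc k H A A (α.rTensor A t)) =
      TensorProduct.assoc k H H A
        ((Coalgebra.comul (R := k)).rTensor A (leftCanonicalMap k H A α t)) := by
  induction t with
  | zero => simp
  | add s t hs ht => simp only [map_add, hs, ht]
  | tmul a b =>
    let N : H ⊗[k] (H ⊗[k] A) →ₗ[k] H ⊗[k] (H ⊗[k] A) :=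
      (LinearMap.mulRight k ((1 : H) ⊗ₜ[k] b)).lTensor H
    have h1 := LinearMap.congr_fun hα.coassoc a
    simp only [LinearMap.comp_apply] at h1
    rw [leftCanonicalMap_tmul, LinearMap.rTensor_tmul]
    have h2 : ∀ t : H ⊗[k] A, (leftCanonicalMap k H A α).lTensor H
        (TensorProduct.assoc k H A A (t ⊗ₜ b)) = N (α.lTensor H t) := by
      intro t
      induction t with
      | zero => simp
      | add s t hs ht => simp only [TensorProduct.add_tmul, map_add, hs, ht]
      | tmul h x => simp [N, leftCanonicalMap_tmul]
    rw [h2, h1]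
    generalize α a = t
    induction t with
    | zero => simp
    | add s t hs ht => simp only [map_add, add_mul, hs, ht]
    | tmul h x =>
      simp only [LinearMap.rTensor_tmul, Algebra.TensorProduct.tmul_mul_tmul, mul_one]
      generalize Coalgebra.comul (R := k) h = d
      induction d with
      | zero => simp
      | add s t hs ht =>
        simp only [LinearEquiv.coe_coe, map_add, TensorProduct.add_tmul] at hs ht ⊢
        rw [hs, ht]
      | tmul a b => simp [N]

/-- The lift `v ↦ κ⁻¹(v₍₋₁₎ ⊗ F(v₍₀₎))` of a linear map through the canonical map. -/
noncomputable def galoisLift (hA : IsLeftGaloisObject k H A α) (lam : V →ₗ[k] H ⊗[k] V)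
    (F : V →ₗ[k] A) : V →ₗ[k] A ⊗[k] A :=
  (LinearEquiv.ofBijective _ hA.bijective).symm.toLinearMap ∘ₗ F.lTensor H ∘ₗ lam

theorem leftCanonicalMap_galoisLift (hA : IsLeftGaloisObject k H A α)
    (F : V →ₗ[k] A) (v : V) :
    leftCanonicalMap k H A α (galoisLift hA lam F v) = F.lTensor H (lam v) :=
  (LinearEquiv.ofBijective _ hA.bijective).apply_symm_apply _

theorem mul'_galoisLift (hA : IsLeftGaloisObject k H A α) (hlam : IsLeftCoaction k H lam)
    (F : V →ₗ[k] A) (v : V) : LinearMap.mul' k A (galoisLift hA lam F v) = F v := by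
  rw [← contract_leftCanonicalMap hA.comodAlg.coaction, leftCanonicalMap_galoisLift,
    contract_lTensor, contract_counit hlam]

theorem isLeftColinear_slice_galoisLift (hA : IsLeftGaloisObject k H A α)
    (hlam : IsLeftCoaction k H lam) (F : V →ₗ[k] A) (ν : Module.Dual k A) :
    IsLeftColinear H lam α (slice ν ∘ₗ galoisLift hA lam F) := by
  have hinj : Function.Injective ((leftCanonicalMap k H A α).lTensor H) :=
    Module.Flat.lTensor_preserves_injective_linearMap _ hA.bijective.1
  have h1 : leftCanonicalMap k H A α ∘ₗ galoisLift hA lam F = F.lTensor H ∘ₗ lam :=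
    LinearMap.ext (leftCanonicalMap_galoisLift hA F)
  have h2 : ∀ v, TensorProduct.assoc k H A A (α.rTensor A (galoisLift hA lam F v)) =
      (galoisLift hA lam F).lTensor H (lam v) := by
    intro v
    apply hinj
    rw [lTensor_leftCanonicalMap hA.comodAlg.coaction, leftCanonicalMap_galoisLift,
      ← LinearMap.lTensor_comp_apply, h1, LinearMap.lTensor_comp_apply]
    have h3 := LinearMap.congr_fun hlam.coassoc v
    simp only [LinearMap.comp_apply] at h3
    rw [h3]
    generalize lam v = t
    induction t with
    | zero => simp
    | add s t hs ht => simp only [map_add, hs, ht]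
    | tmul h x =>
      simp only [LinearMap.rTensor_tmul, LinearMap.lTensor_tmul]
      generalize Coalgebra.comul (R := k) h = d
      induction d with
      | zero => simp
      | add s t hs ht =>
        simp only [LinearEquiv.coe_coe, map_add, TensorProduct.add_tmul] at hs ht ⊢
        rw [hs, ht]
      | tmul a b => simp
  have h4 : ∀ t : A ⊗[k] A, α (slice ν t) =
      (slice ν).lTensor H (TensorProduct.assoc k H A A (α.rTensor A t)) := by
    intro t
    induction t with
    | zero => simp
    | add s t hs ht => simp only [map_add, hs, ht]
    | tmul a b =>
      simp only [slice_tmul, map_smul, LinearMap.rTensor_tmul]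
      generalize α a = t
      induction t with
      | zero => simp
      | add s t hs ht => simp only [map_add, smul_add, TensorProduct.add_tmul, hs, ht]
      | tmul h x => simp
  ext v
  simp only [LinearMap.comp_apply]
  rw [h4, h2, LinearMap.lTensor_comp, LinearMap.comp_apply]

variable (k A) in
theorem exists_dual_one [Nontrivial A] : ∃ ν : Module.Dual k A, ν 1 = 1 :=
  Module.Projective.exists_dual_eq_one k (one_ne_zero (α := A))

/-- A Galois object of a finite-dimensional Hopf algebra is finite-dimensional. -/
theorem finite_of_galois [Module.Finite k H] (hA : IsLeftGaloisObject k H A α) :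
    Module.Finite k A := by
  have := hA.nontrivial
  let K := LinearEquiv.ofBijective _ hA.bijective
  let b := Module.finBasis k H
  obtain ⟨P, hP, hb⟩ := TensorProduct.exists_finite_submodule_left_of_setFinite
    (Set.range fun i ↦ K.symm (b i ⊗ₜ 1)) (Set.finite_range _)
  have hmul : ∀ t ∈ LinearMap.range (P.subtype.rTensor A), ∀ c : A,
      t * (1 ⊗ₜ c) ∈ LinearMap.range (P.subtype.rTensor A) := by
    rintro _ ⟨t, rfl⟩ c
    induction t with
    | zero => simp
    | add s t hs ht =>
      rw [map_add, add_mul]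
      exact add_mem hs ht
    | tmul x y => exact ⟨x ⊗ₜ (y * c), by simp⟩
  have hall : ∀ t : H ⊗[k] A, K.symm t ∈ LinearMap.range (P.subtype.rTensor A) := by
    intro t
    induction t with
    | zero => simp
    | add s t hs ht =>
      rw [map_add]
      exact add_mem hs ht
    | tmul h a =>
      rw [← b.sum_repr h, TensorProduct.sum_tmul, map_sum]
      refine sum_mem fun i _ ↦ ?_
      rw [← TensorProduct.smul_tmul', map_smul]
      refine Submodule.smul_mem _ _ ?_
      have : K.symm (b i ⊗ₜ a) = K.symm (b i ⊗ₜ 1) * (1 ⊗ₜ a) := by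
        apply K.injective
        rw [K.apply_symm_apply]
        change _ = leftCanonicalMap k H A α _
        rw [leftCanonicalMap_mul]
        change _ = K (K.symm _) * _
        rw [K.apply_symm_apply]
        simp
      rw [this]
      exact hmul _ (hb ⟨i, rfl⟩) a
  obtain ⟨ν, hν⟩ := exists_dual_one k A
  have htop : P = ⊤ := by
    refine eq_top_iff.mpr fun a _ ↦ ?_
    have hslice : ∀ t ∈ LinearMap.range (P.subtype.rTensor A), slice ν t ∈ P := by
      rintro _ ⟨t, rfl⟩
      induction t with
      | zero => simp
      | add s t hs ht =>
        rw [map_add, map_add]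
        exact add_mem hs ht
      | tmul x y => simpa using P.smul_mem (ν y) x.2
    have := hslice _ (hall (K (a ⊗ₜ 1)))
    rwa [K.symm_apply_apply, slice_tmul, hν, one_smul] at this
  subst htop
  exact Module.Finite.equiv Submodule.topEquiv

variable [Module (ActRing k H) V] [IsScalarTower k (ActRing k H) V]
variable [Module (ActRing k H) A] [IsScalarTower k (ActRing k H) A]

theorem exists_extend_galois (hA : IsLeftGaloisObject k H A α) (hV : IsComoduleAction lam)
    (hαA : IsComoduleAction α) (U : Submodule (ActRing k H) V) (f : U →ₗ[ActRing k H] A) :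
    ∃ F : V →ₗ[ActRing k H] A, F ∘ₗ U.subtype = f := by
  have := hA.nontrivial
  obtain ⟨lamU, hU, hcol⟩ := exists_isComoduleAction_submodule hV U
  obtain ⟨p, hp⟩ := (U.subtype.restrictScalars k).exists_leftInverse_of_injective
    (LinearMap.ker_eq_bot.mpr Subtype.val_injective)
  obtain ⟨ν, hν⟩ := exists_dual_one k A
  let g := f.restrictScalars k ∘ₗ p
  refine ⟨linearOfColinear hV hαA _ (isLeftColinear_slice_galoisLift hA hV.coaction g ν), ?_⟩
  ext u
  have h1 : galoisLift hA lam g u = f u ⊗ₜ 1 := by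
    apply hA.bijective.1
    have h2 := LinearMap.congr_fun hcol u
    have h3 := LinearMap.congr_fun (isLeftColinear_of_linear hU hαA f) u
    simp only [LinearMap.comp_apply] at h2 h3
    have h4 : lam u = (U.subtype.restrictScalars k).lTensor H (lamU u) := h2
    rw [leftCanonicalMap_galoisLift, leftCanonicalMap_tmul, h4, ← LinearMap.comp_apply,
      ← LinearMap.lTensor_comp, LinearMap.comp_assoc, hp, LinearMap.comp_id, ← h3,
      ← Algebra.TensorProduct.one_def, mul_one]
    rfl
  change slice ν (galoisLift hA lam g u) = f u
  rw [h1, slice_tmul, hν, one_smul]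

theorem finrank_hom_galois [Module.Finite k A] [Module.Finite k V]
    (hA : IsLeftGaloisObject k H A α) (hV : IsComoduleAction lam) (hαA : IsComoduleAction α) :
    Module.finrank k (V →ₗ[ActRing k H] A) = Module.finrank k V := by
  have := hA.nontrivial
  let b := Module.finBasis k A
  let Φ : (Fin (Module.finrank k A) → (V →ₗ[ActRing k H] A)) →ₗ[k] (V →ₗ[k] A) :=
    { toFun := fun f ↦ ∑ i, LinearMap.mulRight k (b i) ∘ₗ (f i).restrictScalars k
      map_add' := fun f g ↦ by
        ext v
        simp [add_mul, Finset.sum_add_distrib]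
      map_smul' := fun c f ↦ by
        ext v
        simp [Finset.smul_sum] }
  have hΦ : ∀ f v, Φ f v = ∑ i, f i v * b i := fun f v ↦ by simp [Φ]
  have hinj : Function.Injective Φ := by
    rw [← LinearMap.ker_eq_bot, LinearMap.ker_eq_bot']
    intro f hf
    ext i v
    have h1 : leftCanonicalMap k H A α (∑ i, f i v ⊗ₜ b i) = (Φ f).lTensor H (lam v) := by
      have h2 : ∀ i, α (f i v) = ((f i).restrictScalars k).lTensor H (lam v) := fun i ↦
        LinearMap.congr_fun (isLeftColinear_of_linear hV hαA (f i)) v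
      rw [map_sum]
      simp only [leftCanonicalMap_tmul, h2]
      generalize lam v = t
      induction t with
      | zero => simp
      | add s t hs ht => simp only [map_add, add_mul, Finset.sum_add_distrib, hs, ht]
      | tmul h x => simp [hΦ, TensorProduct.tmul_sum]
    rw [hf, LinearMap.lTensor_zero, LinearMap.zero_apply] at h1
    have h2 := congrArg (slice (b.coord i)) (hA.bijective.1 (h1.trans (map_zero _).symm))
    simpa [Finsupp.single_apply] using h2
  have hsurj : Function.Surjective Φ := by
    intro F
    refine ⟨fun i ↦ linearOfColinear hV hαA _
      (isLeftColinear_slice_galoisLift hA hV.coaction F (b.coord i)), ?_⟩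
    ext v
    rw [hΦ, ← mul'_galoisLift hA hV.coaction F v]
    simp only [linearOfColinear_apply, LinearMap.comp_apply]
    generalize galoisLift hA lam F v = t
    induction t with
    | zero => simp
    | add s t hs ht => simp only [map_add, add_mul, Finset.sum_add_distrib, hs, ht]
    | tmul x y =>
      rw [LinearMap.mul'_apply]
      conv_rhs => rw [← b.sum_repr y, Finset.mul_sum]
      simp
  have h1 := (LinearEquiv.ofBijective Φ ⟨hinj, hsurj⟩).finrank_eq
  have : Module.Finite k (V →ₗ[ActRing k H] A) :=
    Module.Finite.of_injective (LinearMap.restrictScalarsₗ k (ActRing k H) V A k)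
      (LinearMap.restrictScalars_injective k)
  rw [Module.finrank_pi_fintype, Finset.sum_const, Finset.card_univ, Fintype.card_fin,
    Module.finrank_linearMap k k V A, smul_eq_mul, mul_comm] at h1
  exact Nat.eq_of_mul_eq_mul_right Module.finrank_pos h1

end Galois

section Pointed

variable {k : Type u} [Field k] {H : Type u} [Ring H]
variable {A : Type u} [Ring A] [Algebra k A]

theorem isLeftCoaction_mk [Bialgebra k H] {g : H} (hg : IsGroupLikeElem k g) :
    IsLeftCoaction k H (TensorProduct.mk k H k g) where
  coassoc := by
    ext
    simp [hg.comul_eq_tmul_self]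
  counit := by
    ext
    simp [hg.counit_eq_one]

theorem eq_zero_of_mul_eq_zero [Bialgebra k H]
    {α : A →ₗ[k] H ⊗[k] A} (hA : IsLeftGaloisObject k H A α) {g : H}
    (hg : IsGroupLikeElem k g) {y : A} (hy : ∀ x, α x = g ⊗ₜ x → y * x = 0) : y = 0 := by
  let t := galoisLift hA (TensorProduct.mk k H k g) (LinearMap.toSpanSingleton k A 1) 1
  have ht : LinearMap.mul' k A t = 1 := by
    rw [mul'_galoisLift hA (isLeftCoaction_mk hg)]
    simp
  have hslice : ∀ ν, α (slice ν t) = g ⊗ₜ slice ν t := fun ν ↦ by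
    have := LinearMap.congr_fun (isLeftColinear_slice_galoisLift hA (isLeftCoaction_mk hg)
      (LinearMap.toSpanSingleton k A 1) ν) 1
    simpa using this
  have h1 : (LinearMap.mulLeft k y).rTensor A t = 0 := by
    refine eq_of_slice_eq fun ν ↦ ?_
    have h2 : ∀ t, slice ν ((LinearMap.mulLeft k y).rTensor A t) = y * slice ν t := by
      intro t
      induction t with
      | zero => simp
      | add s t hs ht => simp only [map_add, mul_add, hs, ht]
      | tmul a b => simp
    rw [h2, hy _ (hslice ν), map_zero]
  have h3 : ∀ t, LinearMap.mul' k A ((LinearMap.mulLeft k y).rTensor A t) =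
      y * LinearMap.mul' k A t := by
    intro t
    induction t with
    | zero => simp
    | add s t hs ht => simp only [map_add, mul_add, hs, ht]
    | tmul a b => simp [mul_assoc]
  have h4 := h3 t
  rwa [h1, map_zero, ht, mul_one, eq_comm] at h4

/-- The coinvariants of a Galois object are the scalars. -/
theorem exists_eq_smul_one_of_coinvariant [Bialgebra k H]
    {α : A →ₗ[k] H ⊗[k] A} (hA : IsLeftGaloisObject k H A α) {a : A}
    (ha : α a = 1 ⊗ₜ a) : ∃ c : k, a = c • 1 := by
  have := hA.nontrivial
  obtain ⟨ν, hν⟩ := exists_dual_one k A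
  have h1 : a ⊗ₜ[k] (1 : A) = 1 ⊗ₜ a := by
    apply hA.bijective.1
    rw [leftCanonicalMap_tmul, leftCanonicalMap_tmul, ha, hA.comodAlg.map_one, one_mul]
    simp
  have h2 := congrArg (slice ν) h1
  rw [slice_tmul, slice_tmul, hν, one_smul] at h2
  exact ⟨_, h2⟩

/-- The `g`-homogeneous elements of a Galois object form a line. -/
theorem exists_generator_of_isGroupLikeElem [HopfAlgebra k H]
    {α : A →ₗ[k] H ⊗[k] A} (hA : IsLeftGaloisObject k H A α)
    {g : H} (hg : IsGroupLikeElem k g) :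
    ∃ x : A, x ≠ 0 ∧ α x = g ⊗ₜ x ∧ ∀ z, α z = g ⊗ₜ z → ∃ c : k, z = c • x := by
  have := hA.nontrivial
  set g' := HopfAlgebra.antipode k g
  obtain ⟨y, hy, hy0⟩ : ∃ y : A, α y = g' ⊗ₜ y ∧ y ≠ 0 := by
    by_contra! hcon
    exact one_ne_zero (α := A) (eq_zero_of_mul_eq_zero hA hg.antipode fun x hx ↦ by
      rw [hcon x hx, mul_zero])
  obtain ⟨x, hx, hyx⟩ : ∃ x : A, α x = g ⊗ₜ x ∧ y * x ≠ 0 := by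
    by_contra! hcon
    exact hy0 (eq_zero_of_mul_eq_zero hA hg hcon)
  have hyz : ∀ z, α z = g ⊗ₜ z → ∃ c : k, y * z = c • 1 := fun z hz ↦ by
    refine exists_eq_smul_one_of_coinvariant hA ?_
    rw [hA.comodAlg.map_mul, hy, hz, Algebra.TensorProduct.tmul_mul_tmul, hg.antipode_mul_cancel]
  obtain ⟨c, hc⟩ := hyz x hx
  obtain ⟨d, hd⟩ : ∃ d : k, x * y = d • 1 := by
    refine exists_eq_smul_one_of_coinvariant hA ?_
    rw [hA.comodAlg.map_mul, hy, hx, Algebra.TensorProduct.tmul_mul_tmul, hg.mul_antipode_cancel]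
  have hx0 : x ≠ 0 := fun h ↦ hyx (by rw [h, mul_zero])
  have hdz : ∀ (z : A) (e : k), y * z = e • 1 → d • z = e • x := fun z e he ↦ by
    rw [← one_mul z, ← smul_mul_assoc, ← hd, mul_assoc, he, mul_smul_comm, mul_one]
  have hd0 : d ≠ 0 := by
    rintro rfl
    have h1 := hdz x c hc
    rw [zero_smul, eq_comm, smul_eq_zero] at h1
    rcases h1 with rfl | h1
    · exact hyx (by rw [hc, zero_smul])
    · exact hx0 h1
  refine ⟨x, hx0, hx, fun z hz ↦ ?_⟩
  obtain ⟨e, he⟩ := hyz z hz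
  refine ⟨d⁻¹ * e, ?_⟩
  rw [mul_smul, ← hdz z e he, inv_smul_smul₀ hd0]

section Line

variable {V : Type u} [AddCommGroup V] [Module k V]

theorem exists_isGroupLikeElem_of_finrank_eq_one [Bialgebra k H] {lam : V →ₗ[k] H ⊗[k] V}
    (h : IsLeftCoaction k H lam) (h1 : Module.finrank k V = 1) :
    ∃ g : H, IsGroupLikeElem k g ∧ ∀ v, lam v = g ⊗ₜ v := by
  obtain ⟨s, hs0, hs⟩ := finrank_eq_one_iff'.mp h1
  obtain ⟨μ, hμ⟩ := Module.Projective.exists_dual_eq_one k hs0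
  have hline : ∀ v, v = μ v • s := fun v ↦ by
    obtain ⟨c, rfl⟩ := hs v
    simp [hμ]
  have hsplit : ∀ t : H ⊗[k] V, t = TensorProduct.rid k H (μ.lTensor H t) ⊗ₜ s := by
    intro t
    induction t with
    | zero => simp
    | add s t hs ht => rw [map_add, map_add, TensorProduct.add_tmul, ← hs, ← ht]
    | tmul h x =>
      conv_lhs => rw [hline x]
      simp [TensorProduct.smul_tmul']
  set g := TensorProduct.rid k H (μ.lTensor H (lam s)) with hg
  have hlam : ∀ v, lam v = g ⊗ₜ v := fun v ↦ by
    rw [hline v, map_smul, hsplit (lam s), TensorProduct.tmul_smul]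
  refine ⟨g, ⟨?_, ?_⟩, hlam⟩
  · have h2 := contract_counit h s
    rw [hlam, contract_tmul] at h2
    have h3 := congrArg μ h2
    simpa [hμ] using h3
  · have h2 := LinearMap.congr_fun h.coassoc s
    simp only [LinearMap.comp_apply, hlam, LinearMap.lTensor_tmul, LinearMap.rTensor_tmul] at h2
    have h3 := congrArg (fun t ↦ TensorProduct.rid k (H ⊗[k] H)
      (μ.lTensor (H ⊗[k] H) ((TensorProduct.assoc k H H V).symm t))) h2
    simpa [hμ] using h3.symm

theorem finrank_hom_galois_of_finrank_eq_one [HopfAlgebra k H]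
    {α : A →ₗ[k] H ⊗[k] A} {lam : V →ₗ[k] H ⊗[k] V}
    [Module (ActRing k H) V] [IsScalarTower k (ActRing k H) V]
    [Module (ActRing k H) A] [IsScalarTower k (ActRing k H) A]
    (hA : IsLeftGaloisObject k H A α) (hV : IsComoduleAction lam) (hαA : IsComoduleAction α)
    (h1 : Module.finrank k V = 1) :
    Module.finrank k (V →ₗ[ActRing k H] A) = 1 := by
  obtain ⟨g, hg, hlam⟩ := exists_isGroupLikeElem_of_finrank_eq_one hV.coaction h1
  obtain ⟨x, hx0, hx, hgen⟩ := exists_generator_of_isGroupLikeElem hA hg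
  obtain ⟨s, hs0, hs⟩ := finrank_eq_one_iff'.mp h1
  obtain ⟨μ, hμ⟩ := Module.Projective.exists_dual_eq_one k hs0
  let f₀ : V →ₗ[ActRing k H] A := linearOfColinear hV hαA (μ.smulRight x) (by
    ext v
    simp [hlam, hx])
  have hf₀ : f₀ s = x := by
    change μ s • x = x
    rw [hμ, one_smul]
  refine finrank_eq_one_iff'.mpr ⟨f₀, fun h ↦ hx0 (by rw [← hf₀, h, LinearMap.zero_apply]),
    fun f ↦ ?_⟩
  obtain ⟨c, hc⟩ := hgen (f s) (by
    have := LinearMap.congr_fun (isLeftColinear_of_linear hV hαA f) s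
    simpa [hlam] using this)
  refine ⟨c, LinearMap.ext fun v ↦ ?_⟩
  obtain ⟨d, rfl⟩ := hs v
  rw [LinearMap.map_smul_of_tower, LinearMap.map_smul_of_tower, LinearMap.smul_apply, hf₀, hc]

end Line

section Dual

variable [Bialgebra k H] {V : Type u} [AddCommGroup V] [Module k V] [Module.Finite k V]

/-- The right coaction on the dual of a finite-dimensional left comodule. -/
theorem exists_dual_isRightCoaction {lam : V →ₗ[k] H ⊗[k] V} (h : IsLeftCoaction k H lam) :
    ∃ ρ : Module.Dual k V →ₗ[k] Module.Dual k V ⊗[k] H, IsRightCoaction k H ρ ∧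
      ∀ (φ : Module.Dual k H) (f : Module.Dual k V) (v : V),
        TensorProduct.rid k _ (φ.lTensor _ (ρ f)) v = f (dualAct lam φ v) := by
  classical
  let b := Module.finBasis k V
  let c : Fin (Module.finrank k V) → Fin (Module.finrank k V) → H := fun i j ↦
    TensorProduct.rid k H ((b.coord j).lTensor H (lam (b i)))
  have hlam : ∀ i, lam (b i) = ∑ j, c i j ⊗ₜ b j := by
    intro i
    simp only [c]
    generalize lam (b i) = t
    induction t with
    | zero => simp
    | add s t hs ht =>
      simp only [map_add, TensorProduct.add_tmul, Finset.sum_add_distrib, ← hs, ← ht]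
    | tmul h x =>
      conv_lhs => rw [← b.sum_repr x, TensorProduct.tmul_sum]
      simp [TensorProduct.smul_tmul']
  have hcomul : ∀ i j, Coalgebra.comul (R := k) (c i j) = ∑ l, c i l ⊗ₜ c l j := by
    intro i j
    have h2 := LinearMap.congr_fun h.coassoc (b i)
    simp only [LinearMap.comp_apply, hlam, map_sum, LinearMap.lTensor_tmul,
      LinearMap.rTensor_tmul] at h2
    have h3 := congrArg (fun t ↦ TensorProduct.rid k (H ⊗[k] H)
      ((b.coord j).lTensor (H ⊗[k] H) ((TensorProduct.assoc k H H V).symm t))) h2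
    simpa [TensorProduct.tmul_sum, Finsupp.single_apply, ite_smul] using h3.symm
  have hcounit : ∀ i j, Coalgebra.counit (R := k) (c i j) = if i = j then 1 else 0 := by
    intro i j
    have h2 := contract_counit h (b i)
    rw [hlam, map_sum] at h2
    have h3 := congrArg (b.coord j) h2
    simpa [Finsupp.single_apply] using h3
  let ρ : Module.Dual k V →ₗ[k] Module.Dual k V ⊗[k] H :=
    b.dualBasis.constr k fun j ↦ ∑ i, b.dualBasis i ⊗ₜ c i j
  have hρ : ∀ j, ρ (b.dualBasis j) = ∑ i, b.dualBasis i ⊗ₜ c i j := fun j ↦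
    b.dualBasis.constr_basis k _ j
  refine ⟨ρ, ⟨?_, ?_⟩, ?_⟩
  · refine b.dualBasis.ext fun j ↦ ?_
    simp only [LinearMap.comp_apply, hρ, map_sum, LinearMap.lTensor_tmul, LinearMap.rTensor_tmul,
      hcomul, TensorProduct.sum_tmul, TensorProduct.tmul_sum, LinearEquiv.coe_coe,
      TensorProduct.assoc_tmul]
    exact Finset.sum_comm
  · refine b.dualBasis.ext fun j ↦ ?_
    simp [LinearMap.comp_apply, hρ, hcounit, -Module.Basis.coe_dualBasis]
  · intro φ f v
    let L : Module.Dual k V →ₗ[k] Module.Dual k V :=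
      (TensorProduct.rid k _).toLinearMap ∘ₗ φ.lTensor _ ∘ₗ ρ
    have : L = (dualAct lam φ).dualMap := by
      refine b.dualBasis.ext fun j ↦ b.ext fun m ↦ ?_
      simp only [L, LinearMap.comp_apply, hρ, map_sum, LinearMap.dualMap_apply, dualAct_apply, hlam]
      simp [Finsupp.single_apply]
    exact LinearMap.congr_fun (LinearMap.congr_fun this f) v

variable {lam : V →ₗ[k] H ⊗[k] V} [Module (ActRing k H) V] [IsScalarTower k (ActRing k H) V]

theorem finrank_eq_one_of_isPointed (hH : IsPointed k H) (hV : IsComoduleAction lam)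
    [IsSimpleModule (ActRing k H) V] : Module.finrank k V = 1 := by
  have := IsSimpleModule.nontrivial (ActRing k H) V
  obtain ⟨ρ, hρ, hact⟩ := exists_dual_isRightCoaction hV.coaction
  have hsimple : IsSimpleComodule k H ρ := by
    refine ⟨inferInstance, fun W hW ↦ ?_⟩
    have hstab : ∀ (r : ActRing k H), ∀ v ∈ W.dualCoannihilator, r • v ∈ W.dualCoannihilator := by
      intro r
      induction r using FreeAlgebra.induction with
      | grade0 c =>
        intro v hv
        rw [algebraMap_smul]
        exact Submodule.smul_mem _ c hv
      | grade1 φ =>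
        intro v hv
        rw [Submodule.mem_dualCoannihilator] at hv ⊢
        intro f hf
        rw [hV.smul_eq, ← hact]
        obtain ⟨t, ht⟩ := hW f hf
        refine hv _ ?_
        rw [← ht]
        clear ht
        induction t with
        | zero => simp
        | add s t hs ht =>
          rw [map_add, map_add, map_add]
          exact add_mem hs ht
        | tmul w h => simpa using W.smul_mem _ w.2
      | mul a b ha hb =>
        intro v hv
        rw [mul_smul]
        exact ha _ (hb _ hv)
      | add a b ha hb =>
        intro v hv
        rw [add_smul]
        exact add_mem (ha _ hv) (hb _ hv)
    let P : Submodule (ActRing k H) V :=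
      { W.dualCoannihilator with smul_mem' := fun r v hv ↦ hstab r v hv }
    rw [← Subspace.dualCoannihilator_dualAnnihilator_eq (W := W)]
    rcases eq_bot_or_eq_top P with hP | hP
    · right
      have : W.dualCoannihilator = ⊥ := by
        ext v
        exact (SetLike.ext_iff.mp hP v)
      rw [this, Submodule.dualAnnihilator_bot]
    · left
      have : W.dualCoannihilator = ⊤ := by
        ext v
        exact (SetLike.ext_iff.mp hP v)
      rw [this, Submodule.dualAnnihilator_top]
  rw [← Subspace.dual_finrank_eq]
  exact Module.finrank_eq_of_rank_eq (by rw [hH _ ρ hρ hsimple, Nat.cast_one])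

end Dual

end Pointed

end HopfGalois

/-- If `H` is a finite-dimensional or pointed Hopf algebra, then every
left `H`-Galois object is cleft, i.e. isomorphic to `H` as a left `H`-comodule. -/
theorem galois_cleft_of_finiteDimensional_or_pointed
    (k : Type u) [Field k] (H : Type u) [Ring H] [HopfAlgebra k H]
    (hH : FiniteDimensional k H ∨ IsPointed k H)
    (A : Type u) [Ring A] [Algebra k A] (α : A →ₗ[k] H ⊗[k] A)
    (hA : IsLeftGaloisObject k H A α) :
    ∃ f : H ≃ₗ[k] A, IsLeftColinear H (Coalgebra.comul (R := k)) α (f : H →ₗ[k] A) := by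
  let _ : Module (ActRing k H) H := actModule (Coalgebra.comul (R := k))
  have : IsScalarTower k (ActRing k H) H := isScalarTower_actModule _
  have hHH : IsComoduleAction (Coalgebra.comul (R := k) (A := H)) :=
    isComoduleAction_actModule (isLeftCoaction_comul k H)
  let _ : Module (ActRing k H) A := actModule α
  have : IsScalarTower k (ActRing k H) A := isScalarTower_actModule _
  have hαA : IsComoduleAction α := isComoduleAction_actModule hA.comodAlg.coaction
  have hrank : ∀ (V : Type u) [AddCommGroup V] [Module k V] [Module (ActRing k H) V]
      [IsScalarTower k (ActRing k H) V] [IsSimpleModule (ActRing k H) V]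
      (lam : V →ₗ[k] H ⊗[k] V) (_ : IsComoduleAction lam),
      0 < Module.finrank k (V →ₗ[ActRing k H] H) ∧
        Module.finrank k (V →ₗ[ActRing k H] A) = Module.finrank k (V →ₗ[ActRing k H] H) := by
    intro V _ _ _ _ _ lam hV
    have := finite_of_isSimpleModule hV
    have := IsSimpleModule.nontrivial (ActRing k H) V
    rw [finrank_hom_regular hV hHH]
    refine ⟨Module.finrank_pos, ?_⟩
    rcases hH with hfin | hpt
    · have := finite_of_galois hA
      exact finrank_hom_galois hA hV hαA
    · have h1 := finrank_eq_one_of_isPointed hpt hV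
      rw [finrank_hom_galois_of_finrank_eq_one hA hV hαA h1, h1]
  obtain ⟨e⟩ : Nonempty (H ≃ₗ[ActRing k H] A) := by
    refine nonempty_linearEquiv_of_finrank_eq (k := k) (exists_isSimpleModule_le hHH)
      (exists_isSimpleModule_le hαA) (exists_extend_galois hA hHH hαA)
      (exists_extend_regular hαA hHH) (fun S hS ↦ ?_) (fun S hS ↦ ?_)
    · obtain ⟨lamS, hlamS, -⟩ := exists_isComoduleAction_submodule hHH S
      exact hrank S lamS hlamS
    · obtain ⟨lamS, hlamS, -⟩ := exists_isComoduleAction_submodule hαA S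
      have := hrank S lamS hlamS
      exact ⟨this.2 ▸ this.1, this.2.symm⟩
  exact ⟨e.restrictScalars k, isLeftColinear_of_linear hHH hαA e.toLinearMap⟩
end
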